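/- Let k be a non-archimedean local field of characteristic ≠ 2 and let M be a semi-simple module with M¹ ≠ 0 and M⁰ ≠ 0. Then every quadratic space over k of dimension equal to dim_k(M) has an isometry with module M. -/

import Mathlib

open Polynomial

noncomputable section

variable {k : Type} [Field k]

/-- `f*(X) = f(0)⁻¹ X^{deg f} f(1/X)`. -/
def starPoly (f : k[X]) : k[X] := Polynomial.C (f.coeff 0)⁻¹ * f.reverse

/-- Type 0 : a product of powers of `X - 1` and `X + 1`. -/
def IsType0Pol (f : k[X]) : Prop := ∃ a b : ℕ, f = (X - 1 : k[X]) ^ a * (X + 1) ^ b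

/-- Type 1 : a product of (powers of) monic symmetric irreducible polynomials of even degree. -/
def IsType1Pol (f : k[X]) : Prop :=
  ∃ s : Multiset k[X],
    (∀ g ∈ s, g.Monic ∧ Irreducible g ∧ g = g.reverse ∧ Even g.natDegree) ∧ f = s.prod

/-- Type 2 : a product of polynomials `g * g*` with `g` monic irreducible, `g ≠ ±g*`. -/
def IsType2Pol (f : k[X]) : Prop :=
  ∃ s : Multiset k[X],
    (∀ g ∈ s, g.Monic ∧ Irreducible g ∧ g ≠ starPoly g ∧ g ≠ -starPoly g) ∧
    f = (s.map fun g => g * starPoly g).prod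

/-- A monic polynomial is hyperbolic if it is of the form `G·G*`; equivalently, all its
components of type 0 and 1 occur with an even exponent. -/
def IsHyperbolicPoly (f : k[X]) : Prop := ∃ g : k[X], g.Monic ∧ f = g * starPoly g

/-- Data describing a self-dual torsion `k[X]`-module which is finite dimensional over `k`:
the direct sum, over `i`, of `[k[X]/(f i ^ e i)]^(n i)`, where each `f i` is monic
irreducible, and where the collection is self-dual (stable under `f ↦ f*`). -/
structure ModuleData (k : Type) [Field k] where
  ι : Type
  [fin : Fintype ι]
  f : ι → k[X]
  e : ι → ℕ
  n : ι → ℕ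
  monic : ∀ i, (f i).Monic
  irr : ∀ i, Irreducible (f i)
  epos : ∀ i, 0 < e i
  npos : ∀ i, 0 < n i
  selfdual : ∃ σ : Equiv.Perm ι,
    ∀ i, f (σ i) = starPoly (f i) ∧ e (σ i) = e i ∧ n (σ i) = n i

attribute [instance] ModuleData.fin

namespace ModuleData

variable (D : ModuleData k)

/-- The underlying `K[X]`-module of `M ⊗_k K`, realised concretely, for an extension
`ι : k →+* K`. -/
abbrev SpaceVia {K : Type} [Field K] (ι : k →+* K) : Type :=
  (i : D.ι) → Fin (D.n i) →
    (Polynomial K ⧸ Ideal.span {((D.f i).map ι) ^ D.e i})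

/-- The dimension of `M` as a `k`-vector space. -/
def dim : ℕ := ∑ i, D.n i * (D.e i * (D.f i).natDegree)

/-- The characteristic polynomial `F_M` of `M`. -/
def charPoly : k[X] := ∏ i, D.f i ^ (D.n i * D.e i)

/-- The summand `i` is of type 0 : `f i` is `X - 1` or `X + 1`. -/
def IsIdx0 (i : D.ι) : Prop := D.f i = X - 1 ∨ D.f i = X + 1

/-- The summand `i` is of type 1 : `f i` is symmetric of even degree. -/
def IsIdx1 (i : D.ι) : Prop := D.f i = (D.f i).reverse ∧ Even (D.f i).natDegree

/-- The summand `i` is of type 2 : `f i` is not self-dual. -/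
def IsIdx2 (i : D.ι) : Prop := D.f i ≠ starPoly (D.f i)

open Classical in
/-- `dim_k M⁰`. -/
def dim0 : ℕ := ∑ i, if D.IsIdx0 i then D.n i * (D.e i * (D.f i).natDegree) else 0

open Classical in
/-- `dim_k M¹`. -/
def dim1 : ℕ := ∑ i, if D.IsIdx1 i then D.n i * (D.e i * (D.f i).natDegree) else 0

open Classical in
/-- `dim_k M²`. -/
def dim2 : ℕ := ∑ i, if D.IsIdx2 i then D.n i * (D.e i * (D.f i).natDegree) else 0

/-- `M` is semi-simple : all exponents are 1. -/
def Semisimple : Prop := ∀ i, D.e i = 1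

/-- `M̄_odd` : the direct sum of the summands `[k[X]/(f)]^n`, over those summands
`[k[X]/(f^e)]^n` of `M` with `e` odd and `f` self-dual (`f = f*`). -/
def oddBar : ModuleData k where
  ι := {i : D.ι // Odd (D.e i) ∧ D.f i = starPoly (D.f i)}
  fin := by classical exact inferInstance
  f i := D.f i.1
  e _ := 1
  n i := D.n i.1
  monic i := D.monic i.1
  irr i := D.irr i.1
  epos _ := one_pos
  npos i := D.npos i.1
  selfdual := ⟨Equiv.refl _, fun i => ⟨i.2.2, rfl, rfl⟩⟩

end ModuleData

theorem starPoly_eq_self_of_symm {f : k[X]} (hm : f.Monic) (hs : f = f.reverse) :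
    starPoly f = f := by
  have h0 : f.coeff 0 = 1 := by
    conv_lhs => rw [hs]
    rw [Polynomial.coeff_zero_reverse]
    exact hm
  rw [starPoly, h0, inv_one, map_one, one_mul, ← hs]

/-- The module `[k[X]/(f)]^m` for a monic symmetric irreducible `f`. -/
def ModuleData.single (f : k[X]) (hmon : f.Monic) (hirr : Irreducible f)
    (hsym : f = f.reverse) (m : ℕ) (hm : 0 < m) : ModuleData k where
  ι := Unit
  fin := inferInstance
  f _ := f
  e _ := 1
  n _ := m
  monic _ := hmon
  irr _ := hirr
  epos _ := one_pos
  npos _ := hm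
  selfdual := ⟨Equiv.refl _, fun _ => ⟨(starPoly_eq_self_of_symm hmon hsym).symm, rfl, rfl⟩⟩

section Bilin

variable {V : Type} [AddCommGroup V] [Module k V]

/-- `t` is an isometry of the bilinear space `(V, B)`. -/
def IsIsometryOf (B : LinearMap.BilinForm k V) (t : V ≃ₗ[k] V) : Prop :=
  ∀ x y, B (t x) (t y) = B x y

/-- `(V, B)` is a quadratic space : `B` is a symmetric bilinear form of non-zero
determinant (equivalently, non-degenerate). -/
def IsQuadraticSpace (B : LinearMap.BilinForm k V) : Prop :=
  (∀ x y, B x y = B y x) ∧ (∀ x, (∀ y, B x y = 0) → x = 0)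

/-- The bilinear space `(W, B)` over an extension `ι : k →+* K` has an isometry whose
associated `K[X]`-module is `M ⊗_k K`. -/
def HasIsometryWithModuleVia {K : Type} [Field K] (ι : k →+* K)
    {W : Type} [AddCommGroup W] [Module K W]
    (B : LinearMap.BilinForm K W) (D : ModuleData k) : Prop :=
  ∃ t : W ≃ₗ[K] W, IsIsometryOf B t ∧
    ∃ φ : W ≃ₗ[K] D.SpaceVia ι, ∀ w, φ (t w) = (X : Polynomial K) • φ w

/-- `(V, B)` has an isometry with module `M`. -/
def HasIsometryWithModule (B : LinearMap.BilinForm k V) (D : ModuleData k) : Prop :=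
  HasIsometryWithModuleVia (RingHom.id k) B D

/-- The bilinear space `(W, B)` over an extension `ι : k →+* K` has an isometry with
minimal polynomial (the image of) `f`. -/
def HasIsometryWithMinpolyVia {K : Type} [Field K] (ι : k →+* K)
    {W : Type} [AddCommGroup W] [Module K W]
    (B : LinearMap.BilinForm K W) (f : k[X]) : Prop :=
  ∃ t : W ≃ₗ[K] W, IsIsometryOf B t ∧ minpoly K t.toLinearMap = f.map ι

/-- `(V, B)` has an isometry with minimal polynomial `f`. -/
def HasIsometryWithMinpoly (B : LinearMap.BilinForm k V) (f : k[X]) : Prop :=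
  ∃ t : V ≃ₗ[k] V, IsIsometryOf B t ∧ minpoly k t.toLinearMap = f

/-- A (2n)-dimensional quadratic space is hyperbolic if it has a self-orthogonal subspace
of dimension n. -/
def IsHyperbolicSpace (B : LinearMap.BilinForm k V) : Prop :=
  ∃ W : Submodule k V, (∀ x ∈ W, ∀ y ∈ W, B x y = 0) ∧
    2 * Module.finrank k W = Module.finrank k V

/-- The Witt index : the largest dimension of a totally isotropic subspace. -/
def wittIndex (B : LinearMap.BilinForm k V) : ℕ :=
  sSup {m | ∃ W : Submodule k V, (∀ x ∈ W, ∀ y ∈ W, B x y = 0) ∧ Module.finrank k W = m}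

variable [FiniteDimensional k V]

/-- The Gram matrix of `B` with respect to a fixed basis. -/
def gramOf (B : LinearMap.BilinForm k V) :
    Matrix (Fin (Module.finrank k V)) (Fin (Module.finrank k V)) k :=
  LinearMap.toMatrix₂ (Module.finBasis k V) (Module.finBasis k V) B

/-- The determinant of `B` (well defined modulo nonzero squares). -/
def detOf (B : LinearMap.BilinForm k V) : k := (gramOf B).det

end Bilin

section
open MonoidWithZeroHom

/-- A complete, discretely valued field with finite residue field is a proper ultrametric normed
field. -/
theorem exists_properSpace_of_valued {k : Type} [Field k]
    [Valued k (WithZero (Multiplicative ℤ))] [CompleteSpace k]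
    (hdisc : Function.Surjective
      (Valued.v : Valuation k (WithZero (Multiplicative ℤ))))
    (hres : Finite (Valued.ResidueField k)) :
    ∃ nf : NontriviallyNormedField k,
      nf.toNormedField.toField = ‹Field k› ∧ IsUltrametricDist k ∧ ProperSpace k := by
  obtain ⟨p, hp⟩ := hdisc (WithZero.exp (-1))
  have hp1 : (WithZero.exp (-1) : WithZero (Multiplicative ℤ)) ≠ 1 := by decide
  let r : (Valued.v : Valuation k (WithZero (Multiplicative ℤ))).RankOne :=
    { hom' := (WithZeroMulInt.toNNReal (e := 2) two_ne_zero).comp ValueGroup₀.embedding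
      strictMono' := (WithZeroMulInt.toNNReal_strictMono one_lt_two).comp ValueGroup₀.embedding_strictMono
      exists_val_nontrivial := ⟨p, by rw [hp]; exact ⟨WithZero.exp_ne_zero, hp1⟩⟩ }
  have hcu : IsCyclic (WithZero (Multiplicative ℤ))ˣ :=
    isCyclic_of_surjective (WithZero.unitsWithZeroEquiv (α := Multiplicative ℤ)).symm
      (MulEquiv.surjective _)
  have hc : IsCyclic (valueGroup (.ofClass (Valued.v : Valuation k (WithZero (Multiplicative ℤ))))) := inferInstance
  have hn : Nontrivial (valueGroup (.ofClass (Valued.v : Valuation k (WithZero (Multiplicative ℤ))))) := by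
    rw [Subgroup.nontrivial_iff_exists_ne_one]
    refine ⟨Units.mk0 (Valued.v p) (by rw [hp]; exact WithZero.exp_ne_zero), ?_, ?_⟩
    · exact mem_valueGroup _ ⟨p, rfl⟩
    · intro h
      apply hp1
      rw [← hp]
      exact congrArg Units.val h
  have hd : IsDiscreteValuationRing (Valued.v : Valuation k (WithZero (Multiplicative ℤ))).integer :=
    Valuation.valuationSubring_isDiscreteValuationRing _
  refine ⟨Valued.toNontriviallyNormedField k _, rfl, ?_, ?_⟩
  · let := Valued.toNormedField k (WithZero (Multiplicative ℤ))
    infer_instance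
  · exact Valued.integer.properSpace_iff_completeSpace_and_isDiscreteValuationRing_integer_and_finite_residueField.2 ⟨inferInstance, hd, hres⟩

end

section
open MeasureTheory

section GaussGeneral
variable {V : Type} [AddCommGroup V] [TopologicalSpace V] [IsTopologicalAddGroup V]
  [MeasurableSpace V] [BorelSpace V] [SecondCountableTopology V]

omit [SecondCountableTopology V] in
theorem setIntegral_addSubgroup_translate (μ : Measure V) [μ.IsAddLeftInvariant] (X : AddSubgroup V)
    (hX : MeasurableSet (X : Set V)) (f : V → ℂ) {m : V} (hm : m ∈ X) :
    ∫ x in X, f (x + m) ∂μ = ∫ x in X, f x ∂μ := by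
  rw [← integral_indicator hX, ← integral_indicator hX,
    ← integral_add_right_eq_self ((X : Set V).indicator f) m]
  congr 1
  ext x
  have : x + m ∈ X ↔ x ∈ X := X.add_mem_cancel_right hm
  by_cases h : x ∈ X
  · rw [Set.indicator_of_mem (by exact h), Set.indicator_of_mem (by exact this.2 h)]
  · rw [Set.indicator_of_notMem (by exact h), Set.indicator_of_notMem (by exact fun h' => h (this.1 h'))]

open Classical in
omit [SecondCountableTopology V] in
theorem setIntegral_addSubgroup_character (μ : Measure V) [μ.IsAddLeftInvariant]
    (X : AddSubgroup V) (hX : MeasurableSet (X : Set V)) (χ : V → ℂ)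
    (hχ : ∀ x ∈ X, ∀ m ∈ X, χ (x + m) = χ x * χ m) :
    ∫ x in X, χ x ∂μ = if (∀ x ∈ X, χ x = 1) then (μ.real X : ℂ) else 0 := by
  split_ifs with h
  · rw [setIntegral_congr_fun hX (g := fun _ => (1 : ℂ)) (fun x hx => h x hx)]
    simp [Measure.real]
  · push Not at h
    obtain ⟨m, hm, hm1⟩ := h
    have h1 := setIntegral_addSubgroup_translate μ X hX χ hm
    rw [setIntegral_congr_fun hX (g := fun x => χ x * χ m) (fun x hx => hχ x hx m hm),
      integral_mul_const] at h1
    have : (∫ x in X, χ x ∂μ) * (χ m - 1) = 0 := by rw [mul_sub, h1]; ring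
    exact (mul_eq_zero.1 this).resolve_right (sub_ne_zero.2 hm1)

/-- Averaging over a subgroup `M` on which the quadratic character `f` is trivial. -/
theorem setIntegral_quadratic_character (μ : Measure V) [μ.IsAddLeftInvariant] [SFinite μ]
    (X M : AddSubgroup V) (hX : MeasurableSet (X : Set V)) (hM : MeasurableSet (M : Set V))
    (hMX : M ≤ X) (hXf : μ X ≠ ⊤) (hM0 : μ M ≠ 0)
    (f : V → ℂ) (hf : Continuous f) (hf1 : ∀ x, ‖f x‖ ≤ 1)
    (χ : V → V → ℂ) (hχc : Continuous (fun p : V × V => χ p.1 p.2)) (hχ1 : ∀ x y, ‖χ x y‖ ≤ 1)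
    (hχ : ∀ x y z, χ x (y + z) = χ x y * χ x z)
    (hfχ : ∀ x, ∀ m ∈ M, f (x + m) = f x * χ x m) :
    ∫ x in X, f x ∂μ = ∫ x in ((X : Set V) ∩ {x | ∀ m ∈ M, χ x m = 1}), f x ∂μ := by
  classical
  have hMf : μ M ≠ ⊤ := measure_ne_top_of_subset (by exact hMX) hXf
  have hvM : μ.real M ≠ 0 := by
    rw [Measure.real, ENNReal.toReal_ne_zero]; exact ⟨hM0, hMf⟩
  have : IsFiniteMeasure (μ.restrict X) := ⟨by simpa using hXf.lt_top⟩
  have : IsFiniteMeasure (μ.restrict M) := ⟨by simpa using hMf.lt_top⟩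
  have hcl : IsClosed {x | ∀ m ∈ M, χ x m = 1} := by
    simp only [Set.ofPred_forall]
    refine isClosed_iInter fun m => isClosed_iInter fun _ => isClosed_eq ?_ continuous_const
    exact hχc.comp (by fun_prop : Continuous fun x : V => (x, m))
  have h1 : ∫ m in M, (∫ x in X, f x * χ x m ∂μ) ∂μ = μ.real M * ∫ x in X, f x ∂μ := by
    rw [setIntegral_congr_fun hM (g := fun _ => ∫ x in X, f x ∂μ)]
    · simp [Measure.real]
    · intro m hm
      dsimp only
      rw [← setIntegral_addSubgroup_translate μ X hX f (hMX hm)]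
      exact integral_congr_ae (Filter.Eventually.of_forall fun x => (hfχ x m hm).symm)
  have h2 : ∫ m in M, (∫ x in X, f x * χ x m ∂μ) ∂μ
      = ∫ x in X, (∫ m in M, f x * χ x m ∂μ) ∂μ := by
    apply integral_integral_swap
    apply Integrable.of_bound (C := 1)
    · refine Continuous.aestronglyMeasurable ?_
      exact (hf.comp continuous_snd).mul (hχc.comp continuous_swap)
    · refine Filter.Eventually.of_forall fun p => ?_
      simp only [Function.uncurry, norm_mul]
      exact mul_le_one₀ (hf1 _) (norm_nonneg _) (hχ1 _ _)
  have h3 : ∫ x in X, (∫ m in M, f x * χ x m ∂μ) ∂μ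
      = μ.real M * ∫ x in ((X : Set V) ∩ {x | ∀ m ∈ M, χ x m = 1}), f x ∂μ := by
    rw [← setIntegral_indicator hcl.measurableSet, ← integral_const_mul]
    refine integral_congr_ae (Filter.Eventually.of_forall fun x => ?_)
    simp only [integral_const_mul]
    rw [setIntegral_addSubgroup_character μ M hM (χ x) (fun y _ z _ => hχ x y z)]
    by_cases h : ∀ m ∈ M, χ x m = 1
    · rw [if_pos h, Set.indicator_of_mem (by exact h), mul_comm]
    · rw [if_neg h, Set.indicator_of_notMem (by exact h), mul_zero, mul_zero]
  have := h1.symm.trans (h2.trans h3)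
  exact mul_left_cancel₀ (by exact_mod_cast hvM) this
end GaussGeneral

end

section
open MeasureTheory Metric

section
variable {E : Type} [SeminormedAddCommGroup E] [IsUltrametricDist E]

/-- The closed ball of radius `R` as an additive subgroup. -/
def normBall (E : Type) [SeminormedAddCommGroup E] [IsUltrametricDist E] (R : NNReal) : AddSubgroup E where
  carrier := {x | ‖x‖ ≤ R}
  zero_mem' := by simp
  add_mem' {x y} hx hy := (IsUltrametricDist.norm_add_le_max x y).trans (max_le hx hy)
  neg_mem' {x} hx := by simpa using hx

theorem mem_normBall {R : NNReal} {x : E} : x ∈ normBall E R ↔ ‖x‖ ≤ R := Iff.rfl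

theorem coe_normBall (R : NNReal) : (normBall E R : Set E) = closedBall 0 R := by
  ext x; simp [mem_normBall]

theorem normBall_mono {R S : NNReal} (h : R ≤ S) : normBall E R ≤ normBall E S :=
  fun _ hx => le_trans (mem_normBall.1 hx) (NNReal.coe_le_coe.2 h)
end

section
variable {k : Type} [NontriviallyNormedField k] [IsUltrametricDist k] [ProperSpace k]

variable (k) in
theorem exists_uniformizer_norm : ∃ p : k, p ≠ 0 ∧ ‖p‖ < 1 ∧ ∀ x : k, ‖x‖ < 1 → ‖x‖ ≤ ‖p‖ := by
  have hc : IsCompact (ball (0 : k) 1) :=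
    (isCompact_closedBall (0 : k) 1).of_isClosed_subset
      (IsUltrametricDist.isClosed_ball _ _) ball_subset_closedBall
  obtain ⟨p, hp, hmax⟩ := hc.exists_isMaxOn ⟨0, by simp⟩ continuous_norm.continuousOn
  obtain ⟨y, hy0, hy1⟩ := NormedField.exists_norm_lt_one k
  have h1 : ∀ x : k, ‖x‖ < 1 → ‖x‖ ≤ ‖p‖ := fun x hx => hmax (by simpa using hx)
  refine ⟨p, ?_, by simpa using hp, h1⟩
  exact norm_pos_iff.1 (hy0.trans_le (h1 y hy1))

/-- Properties of an additive character of conductor the ring of integers. -/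
structure IsStdChar (e : k → ℂ) : Prop where
  cont : Continuous e
  add : ∀ x y, e (x + y) = e x * e y
  norm : ∀ x, ‖e x‖ = 1
  triv : ∀ x, ‖x‖ ≤ 1 → e x = 1
  cond : ∀ t, (∀ a, ‖a‖ ≤ 1 → e (a * t) = 1) → ‖t‖ ≤ 1

/-- `ℚ/ℤ → Circle`. -/
def ratCircleHom : AddCircle (1 : ℚ) →+ AddCircle (1 : ℝ) :=
  QuotientAddGroup.map _ _ (Rat.castHom ℝ).toAddMonoidHom (by simp)

theorem ratCircleHom_injective : Function.Injective ratCircleHom := by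
  rw [injective_iff_map_eq_zero]
  intro a
  induction a using QuotientAddGroup.induction_on with
  | H q =>
    intro h
    have h' : (((q : ℚ) : ℝ) : AddCircle (1:ℝ)) = 0 := h
    rw [AddCircle.coe_eq_zero_iff] at h'
    obtain ⟨n, hn⟩ := h'
    refine (AddCircle.coe_eq_zero_iff 1).2 ⟨n, ?_⟩
    have : ((n • (1 : ℚ) : ℚ) : ℝ) = (q : ℝ) := by rw [← hn]; simp
    exact_mod_cast this

variable (k) in
theorem exists_isStdChar : ∃ e : k → ℂ, IsStdChar e := by
  obtain ⟨p, hp0, hp1, hp⟩ := exists_uniformizer_norm k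
  let O := normBall k 1
  have hne : ((p⁻¹ : k) : k ⧸ O) ≠ 0 := by
    rw [Ne, QuotientAddGroup.eq_zero_iff, mem_normBall, norm_inv]
    exact not_le.2 ((one_lt_inv₀ (norm_pos_iff.2 hp0)).2 hp1)
  obtain ⟨c, hc⟩ := CharacterModule.exists_character_apply_ne_zero_of_ne_zero hne
  let g : k → AddCircle (1 : ℝ) := fun x => ratCircleHom (c (x : k ⧸ O))
  have hg : ∀ x y, g (x + y) = g x + g y := fun x y => by
    simp only [g, QuotientAddGroup.mk_add, map_add]
  have hgO : ∀ x, ‖x‖ ≤ 1 → g x = 0 := fun x hx => by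
    have : (x : k ⧸ O) = 0 := (QuotientAddGroup.eq_zero_iff x).2 (by simpa [O, mem_normBall] using hx)
    simp only [g, this, map_zero]
  refine ⟨fun x => (g x).toCircle, ?_, ?_, ?_, ?_, ?_⟩
  · refine IsLocallyConstant.continuous ((IsLocallyConstant.iff_exists_open _).2 fun x =>
      ⟨ball x 1, isOpen_ball, by simp, fun y hy => ?_⟩)
    have : g y = g x := by
      rw [← sub_add_cancel y x, hg, hgO, zero_add]
      rw [mem_ball, dist_eq_norm] at hy
      exact hy.le
    simp only [this]
  · intro x y
    simp only [hg, AddCircle.toCircle_add, Circle.coe_mul]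
  · exact fun x => Circle.norm_coe _
  · intro x hx; simp [hgO x hx]
  · intro t ht
    by_contra hlt
    push Not at hlt
    have ht0 : t ≠ 0 := by rintro rfl; simp at hlt; linarith
    have h1 : ‖p⁻¹ * t⁻¹‖ ≤ 1 := by
      have := hp t⁻¹ (by rw [norm_inv]; exact inv_lt_one_of_one_lt₀ hlt)
      rw [norm_mul, norm_inv p]
      rw [inv_mul_le_iff₀ (norm_pos_iff.2 hp0)]; simpa using this
    have h2 := ht _ h1
    rw [inv_mul_cancel_right₀ ht0] at h2
    have h3 : (g p⁻¹).toCircle = AddCircle.toCircle (0 : AddCircle (1 : ℝ)) := by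
      rw [AddCircle.toCircle_zero]
      exact Circle.ext (by simpa using h2)
    have h4 := AddCircle.injective_toCircle one_ne_zero h3
    apply hc
    exact ratCircleHom_injective (h4.trans (map_zero _).symm)
end

end

section
open MeasureTheory Metric

section
variable {k : Type} [NontriviallyNormedField k] [IsUltrametricDist k] [ProperSpace k]
variable {E : Type} [NormedAddCommGroup E] [NormedSpace k E] [FiniteDimensional k E]

omit [IsUltrametricDist k] in
theorem exists_pos_le_of_homogeneous {W : Type} [TopologicalSpace W] {S : Set W} (hS : IsCompact S)
    (g : W → E → ℝ) (hg : Continuous fun p : W × E => g p.1 p.2) {d : ℕ} (hd : d ≠ 0)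
    (hhom : ∀ w (c : k) x, g w (c • x) = ‖c‖ ^ d * g w x)
    (hpos : ∀ w ∈ S, ∀ x, x ≠ 0 → 0 < g w x) :
    ∃ δ > 0, ∀ w ∈ S, ∀ x, δ * ‖x‖ ^ d ≤ g w x := by
  have : ProperSpace E := FiniteDimensional.proper k E
  obtain ⟨c, hc⟩ := NormedField.exists_one_lt_norm k
  have hc0 : 0 < ‖c‖ := one_pos.trans hc
  let T : Set E := closedBall 0 1 ∩ {x | 1 / ‖c‖ ≤ ‖x‖}
  have hT : IsCompact T := (isCompact_closedBall (0 : E) 1).inter_right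
    (isClosed_le continuous_const continuous_norm)
  obtain ⟨δ, hδ0, hδ⟩ := (hS.prod hT).exists_forall_le' hg.continuousOn (a := 0) (by
    rintro ⟨w, x⟩ ⟨hw, hx⟩
    refine hpos w hw x ?_
    rintro rfl
    have : 1 / ‖c‖ ≤ ‖(0 : E)‖ := hx.2
    rw [norm_zero] at this
    exact absurd this (not_le.2 (by positivity)))
  refine ⟨δ, hδ0, fun w hw x => ?_⟩
  by_cases hx : x = 0
  · subst hx
    have := hhom w 0 0
    rw [zero_smul, norm_zero, zero_pow hd, zero_mul] at this
    rw [this, norm_zero, zero_pow hd, mul_zero]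
  · obtain ⟨a, ha0, ha1, ha2, -⟩ := rescale_to_shell hc one_pos hx
    have h1 := hδ (w, a • x) ⟨hw, by simpa using ha1.le, ha2⟩
    rw [hhom] at h1
    have ha : 0 < ‖a‖ := norm_pos_iff.2 ha0
    rw [norm_smul] at ha1
    have h2 : (‖a‖ * ‖x‖) ^ d ≤ 1 := pow_le_one₀ (by positivity) ha1.le
    rw [mul_pow] at h2
    have h3 : 0 < ‖a‖ ^ d := by positivity
    refine le_of_mul_le_mul_left ?_ h3
    calc ‖a‖ ^ d * (δ * ‖x‖ ^ d) = δ * (‖a‖ ^ d * ‖x‖ ^ d) := by ring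
      _ ≤ δ * 1 := by gcongr
      _ ≤ _ := by simpa using h1

omit [IsUltrametricDist k] in
theorem continuous_bilinear (B : LinearMap.BilinForm k E) :
    Continuous (fun p : E × E => B p.1 p.2) := by
  let T : (E →ₗ[k] k) →ₗ[k] (E →L[k] k) := (LinearMap.toContinuousLinearMap).toLinearMap
  let B' : E →L[k] E →L[k] k := LinearMap.toContinuousLinearMap (T ∘ₗ B)
  have : (fun p : E × E => B p.1 p.2) = fun p => B' p.1 p.2 := rfl
  rw [this]
  fun_prop

omit [IsUltrametricDist k] in
theorem continuous_trilinear {W : Type} [NormedAddCommGroup W] [NormedSpace k W]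
    [FiniteDimensional k W] (β : W →ₗ[k] LinearMap.BilinForm k E) :
    Continuous (fun p : W × E × E => β p.1 p.2.1 p.2.2) := by
  let b := Module.finBasis k W
  have h : (fun p : W × E × E => β p.1 p.2.1 p.2.2)
      = fun p => ∑ i, b.coord i p.1 * β (b i) p.2.1 p.2.2 := by
    ext p
    conv_lhs => rw [← b.sum_repr p.1, map_sum, LinearMap.sum_apply, LinearMap.sum_apply]
    simp
  rw [h]
  refine continuous_finsetSum _ fun i _ => Continuous.mul ?_ ?_
  · exact (LinearMap.continuous_of_finiteDimensional (b.coord i)).comp continuous_fst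
  · exact (continuous_bilinear (β (b i))).comp continuous_snd

/-- The dual (up to the factor 2) of a ball for a bilinear form. -/
def ballDual (B : LinearMap.BilinForm k E) (ρ : NNReal) : Set E :=
  {x | ∀ m : E, ‖m‖ ≤ ρ → ‖2 * B x m‖ ≤ 1}

omit [IsUltrametricDist k] in
theorem setIntegral_quadratic_stable [IsUltrametricDist E] [MeasurableSpace E] [BorelSpace E]
    (μ : Measure E) [μ.IsAddHaarMeasure]
    {e : k → ℂ} (he : IsStdChar e) (B : LinearMap.BilinForm k E) (hB : ∀ x y, B x y = B y x)
    {ρ : NNReal} (hρ : 0 < ρ) (hBρ : ∀ m : E, ‖m‖ ≤ ρ → ‖B m m‖ ≤ 1)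
    (X : AddSubgroup E) (hX : MeasurableSet (X : Set E)) (hXf : μ X ≠ ⊤)
    (h1 : normBall E ρ ≤ X) (h2 : ballDual B ρ ⊆ X) :
    ∫ x in X, e (B x x) ∂μ = ∫ x in ballDual B ρ, e (B x x) ∂μ := by
  have : ProperSpace E := FiniteDimensional.proper k E
  have hBc := continuous_bilinear B
  have hd : {x : E | ∀ m ∈ normBall E ρ, e (2 * B x m) = 1} = ballDual B ρ := by
    ext x
    refine ⟨fun h m hm => he.cond _ fun a ha => ?_, fun h m hm => he.triv _ (h m hm)⟩
    have := h (a • m) (by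
      rw [mem_normBall, norm_smul]
      exact (mul_le_of_le_one_left (norm_nonneg _) ha).trans hm)
    rw [map_smul, smul_eq_mul] at this
    rw [← this]; congr 1; ring
  rw [setIntegral_quadratic_character μ X (normBall E ρ) hX
    (by rw [coe_normBall]; exact isClosed_closedBall.measurableSet) h1 hXf
    (by rw [coe_normBall]; exact (measure_closedBall_pos μ 0 (by exact_mod_cast hρ)).ne')
    (fun x => e (B x x)) (he.cont.comp (hBc.comp (by fun_prop : Continuous fun x : E => (x, x))))
    (fun x => (he.norm _).le) (fun x m => e (2 * B x m))
    (he.cont.comp (continuous_const.mul hBc)) (fun x y => (he.norm _).le)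
    (fun x y z => by rw [map_add, mul_add, he.add])
    (fun x m hm => by
      have h3 : B (x + m) (x + m) = B x x + 2 * B x m + B m m := by
        simp only [map_add, LinearMap.add_apply, hB m x]; ring
      rw [h3, he.add, he.add, he.triv _ (hBρ m hm), mul_one]), hd, Set.inter_eq_self_of_subset_right h2]

omit [IsUltrametricDist k] in
/-- For a compact family of nondegenerate forms, integrals over large balls are all
equal, uniformly in the parameter. -/
theorem exists_ball_uniform {W : Type} [NormedAddCommGroup W] [NormedSpace k W]
    [FiniteDimensional k W] (β : W →ₗ[k] LinearMap.BilinForm k E) {S : Set W} (hS : IsCompact S)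
    (h2 : (2 : k) ≠ 0)
    (hnd : ∀ w ∈ S, ∀ x, (∀ y, β w x y = 0) → x = 0) :
    ∃ ρ R : NNReal, 0 < ρ ∧ ρ ≤ R ∧ (∀ w ∈ S, ∀ m : E, ‖m‖ ≤ ρ → ‖β w m m‖ ≤ 1) ∧
      ∀ w ∈ S, ballDual (β w) ρ ⊆ {x | ‖x‖ ≤ R} := by
  have : ProperSpace E := FiniteDimensional.proper k E
  have hc := continuous_trilinear β
  have hρ : ∃ ρ : NNReal, 0 < ρ ∧ ∀ w ∈ S, ∀ m : E, ‖m‖ ≤ ρ → ‖β w m m‖ ≤ 1 := by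
    have hq : Continuous fun p : W × E => ‖β p.1 p.2 p.2‖ :=
      (hc.comp (by fun_prop : Continuous fun p : W × E => (p.1, p.2, p.2))).norm
    obtain ⟨C, hC⟩ := (hS.prod (isCompact_closedBall (0 : E) 1)).exists_bound_of_continuousOn
      hq.continuousOn
    obtain ⟨a, ha0, ha⟩ := NormedField.exists_norm_lt k (r := min 1 (1 / (max C 1))) (by positivity)
    have ha1 : ‖a‖ < 1 := ha.trans_le (min_le_left _ _)
    have haC : ‖a‖ * max C 1 ≤ 1 := by
      have := ha.le.trans (min_le_right _ _)
      rwa [le_div_iff₀ (by positivity)] at this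
    refine ⟨‖a‖₊, by exact_mod_cast ha0, fun w hw m hm => ?_⟩
    have ha' : a ≠ 0 := norm_pos_iff.1 ha0
    obtain ⟨y, rfl⟩ : ∃ y, a • y = m := ⟨a⁻¹ • m, smul_inv_smul₀ ha' _⟩
    have hn : ‖y‖ ≤ 1 := by
      rw [norm_smul] at hm
      exact le_of_mul_le_mul_left (by simpa using hm) ha0
    have := hC (w, y) ⟨hw, by simpa using hn⟩
    rw [norm_norm] at this
    rw [map_smul, map_smul, LinearMap.smul_apply, smul_smul, norm_smul, norm_mul]
    calc ‖a‖ * ‖a‖ * _ ≤ ‖a‖ * ‖a‖ * max C 1 := by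
          gcongr; exact this.trans (le_max_left _ _)
      _ = ‖a‖ * (‖a‖ * max C 1) := by ring
      _ ≤ 1 * 1 := by gcongr
      _ = 1 := one_mul 1
  obtain ⟨ρ, hρ0, hρ⟩ := hρ
  let b := Module.finBasis k E
  have hsc : ∀ i, ∃ a : k, a ≠ 0 ∧ ‖a • b i‖ ≤ ρ := fun i => by
    obtain ⟨a, ha0, ha⟩ := NormedField.exists_norm_lt k (r := ρ / (‖b i‖ + 1)) (by positivity)
    refine ⟨a, norm_pos_iff.1 ha0, ?_⟩
    rw [lt_div_iff₀ (by positivity)] at ha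
    rw [norm_smul]
    nlinarith
  choose a ha0 ha using hsc
  let g : W → E → ℝ := fun w x => ∑ i, ‖2 * β w x (a i • b i)‖
  have hg : Continuous fun p : W × E => g p.1 p.2 := by
    refine continuous_finsetSum _ fun i _ => (continuous_const.mul ?_).norm
    exact hc.comp (by fun_prop : Continuous fun p : W × E => (p.1, p.2, a i • b i))
  obtain ⟨δ, hδ0, hδ⟩ := exists_pos_le_of_homogeneous (k := k) hS g hg one_ne_zero
    (fun w c x => by
      simp only [g, Finset.mul_sum]
      refine Finset.sum_congr rfl fun i _ => ?_
      rw [map_smul (β w), LinearMap.smul_apply, smul_eq_mul, mul_left_comm, norm_mul, pow_one])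
    (fun w hw x hx => by
      by_contra hle
      have h0 : g w x = 0 := le_antisymm (not_lt.1 hle) (Finset.sum_nonneg fun _ _ => norm_nonneg _)
      rw [Finset.sum_eq_zero_iff_of_nonneg (fun _ _ => norm_nonneg _)] at h0
      apply hx
      apply hnd w hw
      have : β w x = 0 := by
        refine b.ext fun i => ?_
        have := norm_eq_zero.1 (h0 i (Finset.mem_univ _))
        rw [map_smul, smul_eq_mul] at this
        simpa [h2, ha0 i] using this
      simp [this])
  refine ⟨ρ, max ρ (Real.toNNReal (Module.finrank k E / δ)), hρ0, le_max_left _ _, hρ, ?_⟩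
  intro w hw x hx
  have h3 : g w x ≤ Module.finrank k E := by
    calc g w x ≤ ∑ i : Fin (Module.finrank k E), (1 : ℝ) :=
          Finset.sum_le_sum fun i _ => hx _ (ha i)
      _ = _ := by simp
  have h4 := (hδ w hw x).trans h3
  rw [pow_one, mul_comm, ← le_div_iff₀ hδ0] at h4
  exact h4.trans ((Real.le_coe_toNNReal _).trans (by rw [NNReal.coe_max]; exact le_max_right _ _))
end

end

section
open MeasureTheory Metric

theorem IsStdChar.zero {k : Type} [NontriviallyNormedField k] {e : k → ℂ} (he : IsStdChar e) : e 0 = 1 :=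
  he.triv 0 (by simp)

theorem IsStdChar.neg {k : Type} [NontriviallyNormedField k] {e : k → ℂ} (he : IsStdChar e) (x : k) :
    e (-x) = (starRingEnd ℂ) (e x) := by
  have h1 : e x * e (-x) = 1 := by rw [← he.add, add_neg_cancel, he.zero]
  have h2 : e x * (starRingEnd ℂ) (e x) = 1 := by
    rw [Complex.mul_conj, Complex.normSq_eq_norm_sq, he.norm]; simp
  have h0 : e x ≠ 0 := fun h => by simp [h] at h1
  exact mul_left_cancel₀ h0 (h1.trans h2.symm)

theorem IsStdChar.sum {k ι : Type} [NontriviallyNormedField k] {e : k → ℂ} (he : IsStdChar e)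
    (s : Finset ι) (f : ι → k) : e (∑ i ∈ s, f i) = ∏ i ∈ s, e (f i) := by
  classical
  induction s using Finset.induction_on with
  | empty => simp [he.zero]
  | insert a s ha ih => rw [Finset.sum_insert ha, Finset.prod_insert ha, he.add, ih]

section
variable {k : Type} [NontriviallyNormedField k] [ProperSpace k]
variable {E : Type} [NormedAddCommGroup E] [NormedSpace k E] [FiniteDimensional k E]
variable [IsUltrametricDist E] [MeasurableSpace E] [BorelSpace E]

theorem normBall_measurable {E : Type} [NormedAddCommGroup E] [IsUltrametricDist E]
    [MeasurableSpace E] [BorelSpace E] (R : NNReal) : MeasurableSet (normBall E R : Set E) := by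
  rw [coe_normBall]; exact isClosed_closedBall.measurableSet

theorem normBall_ne_top {E : Type} [NormedAddCommGroup E] [IsUltrametricDist E] [ProperSpace E]
    [MeasurableSpace E] (μ : Measure E) [IsFiniteMeasureOnCompacts μ] (R : NNReal) :
    μ (normBall E R) ≠ ⊤ := by
  rw [coe_normBall]; exact (isCompact_closedBall _ _).measure_lt_top.ne

omit [IsUltrametricDist E] [MeasurableSpace E] [BorelSpace E] in
theorem exists_bound_bilinear (B : LinearMap.BilinForm k E) :
    ∃ C > 0, ∀ x y, ‖B x y‖ ≤ C * ‖x‖ * ‖y‖ := by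
  let T : (E →ₗ[k] k) →ₗ[k] (E →L[k] k) := (LinearMap.toContinuousLinearMap).toLinearMap
  let B' : E →L[k] E →L[k] k := LinearMap.toContinuousLinearMap (T ∘ₗ B)
  refine ⟨‖B'‖ + 1, by positivity, fun x y => ?_⟩
  have : ‖B x y‖ ≤ ‖B'‖ * ‖x‖ * ‖y‖ := B'.le_opNorm₂ x y
  refine this.trans ?_
  gcongr
  linarith

omit [IsUltrametricDist E] [MeasurableSpace E] [BorelSpace E] in
theorem ballDual_nhds (B : LinearMap.BilinForm k E) (R : NNReal) : ballDual B R ∈ nhds 0 := by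
  obtain ⟨C, hC0, hC⟩ := exists_bound_bilinear B
  have : 0 < 1 / (‖(2:k)‖ * C * R + 1) := by positivity
  refine Filter.mem_of_superset (closedBall_mem_nhds (0 : E) this) fun x hx m hm => ?_
  rw [mem_closedBall_zero_iff, le_div_iff₀ (by positivity)] at hx
  rw [norm_mul]
  calc ‖(2 : k)‖ * ‖B x m‖ ≤ ‖(2 : k)‖ * (C * ‖x‖ * R) := by
        gcongr; exact (hC x m).trans (by gcongr)
    _ ≤ 1 := by nlinarith [norm_nonneg x]

omit [IsUltrametricDist E] [MeasurableSpace E] [BorelSpace E] in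
theorem exists_ballDual_subset (B : LinearMap.BilinForm k E) (h2 : (2 : k) ≠ 0)
    (hnd : ∀ x, (∀ y, B x y = 0) → x = 0) :
    ∃ ρ R : NNReal, 0 < ρ ∧ ρ ≤ R ∧ (∀ m : E, ‖m‖ ≤ ρ → ‖B m m‖ ≤ 1) ∧
      ballDual B ρ ⊆ {x | ‖x‖ ≤ R} ∧ ∀ R' ≥ R, ballDual B R' ⊆ {x | ‖x‖ ≤ ρ} := by
  obtain ⟨ρ, R, h0, h1, hB, hd⟩ := exists_ball_uniform (LinearMap.toSpanSingleton k _ B)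
    (isCompact_singleton (x := (1 : k))) h2 (by simpa using hnd)
  simp only [Set.mem_singleton_iff, forall_eq, LinearMap.toSpanSingleton_apply, one_smul] at hB hd
  obtain ⟨t, ht⟩ := NormedField.exists_lt_norm k (R / ρ)
  have ht0 : 0 < ‖t‖ := lt_of_le_of_lt (by positivity) ht
  refine ⟨ρ, max R (‖t‖₊ * ρ), h0, h1.trans (le_max_left _ _), hB,
    hd.trans fun x (hx : ‖x‖ ≤ R) => hx.trans (NNReal.coe_le_coe.2 (le_max_left _ _)), ?_⟩
  intro R' hR' x hx
  have h3 : t • x ∈ ballDual B ρ := by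
    intro m hm
    have := hx (t • m) (by
      rw [norm_smul]
      calc ‖t‖ * ‖m‖ ≤ ‖t‖ * ρ := by gcongr
        _ ≤ R' := by exact_mod_cast (le_max_right _ _).trans hR')
    rwa [map_smul] at this ⊢
  have h4 : ‖t • x‖ ≤ R := hd h3
  rw [norm_smul] at h4
  rw [div_lt_iff₀ (by exact_mod_cast h0)] at ht
  exact le_of_mul_le_mul_left (h4.trans ht.le) ht0

theorem setIntegral_ball_ne_zero (μ : Measure E) [μ.IsAddHaarMeasure]
    {e : k → ℂ} (he : IsStdChar e) (B : LinearMap.BilinForm k E) (hB : ∀ x y, B x y = B y x)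
    {ρ R : NNReal} (hBρ : ∀ m : E, ‖m‖ ≤ ρ → ‖B m m‖ ≤ 1)
    (hR : ballDual B R ⊆ {x | ‖x‖ ≤ ρ}) (hR0 : 0 < R) :
    ∫ x in normBall E R, e (B x x) ∂μ ≠ 0 := by
  have : ProperSpace E := FiniteDimensional.proper k E
  have hBc := continuous_bilinear B
  have hX := normBall_measurable (E := E) R
  have hf := normBall_ne_top μ R
  have : IsFiniteMeasure (μ.restrict (normBall E R)) := ⟨by simpa using hf.lt_top⟩
  set I := ∫ x in normBall E R, e (B x x) ∂μ with hI
  have hconj : (starRingEnd ℂ) I = ∫ y in normBall E R, e (-B y y) ∂μ := by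
    rw [hI, ← integral_conj]
    simp only [he.neg]
  have hcl : MeasurableSet (ballDual B R) := by
    simp only [ballDual, Set.ofPred_forall]
    refine (isClosed_iInter fun m => isClosed_iInter fun _ =>
      isClosed_le ?_ continuous_const).measurableSet
    exact (continuous_const.mul (hBc.comp (by fun_prop : Continuous fun x : E => (x, m)))).norm
  have h1 : I * (starRingEnd ℂ) I = ∫ y in normBall E R, ∫ u in normBall E R,
      e (B u u) * e (2 * B u y) ∂μ ∂μ := by
    rw [hconj, ← integral_const_mul]
    refine setIntegral_congr_fun hX fun y hy => ?_
    rw [hI, ← setIntegral_addSubgroup_translate μ _ hX (fun x => e (B x x)) hy, ← integral_mul_const]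
    refine integral_congr_ae (Filter.Eventually.of_forall fun u => ?_)
    dsimp only
    rw [← he.add, ← he.add]
    congr 1
    simp only [map_add, LinearMap.add_apply, hB y u]; ring
  have h2 : ∫ y in normBall E R, ∫ u in normBall E R, e (B u u) * e (2 * B u y) ∂μ ∂μ
      = ∫ u in normBall E R, ∫ y in normBall E R, e (B u u) * e (2 * B u y) ∂μ ∂μ := by
    apply integral_integral_swap
    apply Integrable.of_bound (C := 1)
    · refine Continuous.aestronglyMeasurable ?_
      refine (he.cont.comp (hBc.comp (by fun_prop : Continuous fun x : E × E => (x.2, x.2)))).mul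
        (he.cont.comp (continuous_const.mul (hBc.comp continuous_swap)))
    · refine Filter.Eventually.of_forall fun p => ?_
      simp [Function.uncurry, he.norm]
  have h3 : ∫ u in normBall E R, ∫ y in normBall E R, e (B u u) * e (2 * B u y) ∂μ ∂μ
      = μ.real (normBall E R) * μ.real (normBall E R ∩ ballDual B R) := by
    have : ∀ u, ∫ y in normBall E R, e (B u u) * e (2 * B u y) ∂μ
        = (ballDual B R).indicator (fun _ => (μ.real (normBall E R) : ℂ)) u := by
      intro u
      rw [integral_const_mul, setIntegral_addSubgroup_character μ _ hX (fun y => e (2 * B u y))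
        (fun x _ y _ => by rw [map_add, mul_add, he.add])]
      by_cases hu : u ∈ ballDual B R
      · rw [if_pos (show ∀ y ∈ normBall E R, e (2 * B u y) = 1 from
          fun y hy => he.triv _ (hu y hy)), Set.indicator_of_mem hu,
          he.triv _ (hBρ _ (hR hu)), one_mul]
      · rw [if_neg, Set.indicator_of_notMem hu, mul_zero]
        intro h
        refine hu fun m hm => he.cond _ fun a ha => ?_
        have := h (a • m) (by
          rw [mem_normBall, norm_smul]
          exact (mul_le_of_le_one_left (norm_nonneg _) ha).trans hm)
        rw [map_smul, smul_eq_mul] at this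
        rw [← this]; congr 1; ring
    simp only [this]
    rw [setIntegral_indicator hcl]
    simp [Measure.real, mul_comm]
  intro h0
  rw [h0, zero_mul, h2, h3] at h1
  have h5 : μ.real (normBall E R) * μ.real (normBall E R ∩ ballDual B R) = 0 := by
    exact_mod_cast h1.symm
  have hn : (normBall E R : Set E) ∈ nhds 0 := by
    rw [coe_normBall]; exact closedBall_mem_nhds _ (by exact_mod_cast hR0)
  have hpos : ∀ s : Set E, s ∈ nhds 0 → s ⊆ normBall E R → μ.real s ≠ 0 := fun s hs hs' => by
    rw [Measure.real, ENNReal.toReal_ne_zero]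
    exact ⟨(Measure.measure_pos_of_mem_nhds μ hs).ne', measure_ne_top_of_subset hs' hf⟩
  exact mul_ne_zero (hpos _ hn subset_rfl)
    (hpos _ (Filter.inter_mem hn (ballDual_nhds B R)) Set.inter_subset_left) h5

theorem exists_phase (μ : Measure E) [μ.IsAddHaarMeasure] (h2 : (2 : k) ≠ 0)
    {e : k → ℂ} (he : IsStdChar e) (B : LinearMap.BilinForm k E) (hB : ∀ x y, B x y = B y x)
    (hnd : ∀ x, (∀ y, B x y = 0) → x = 0) :
    ∃ I : ℂ, I ≠ 0 ∧ ∃ R0 : NNReal, ∀ R ≥ R0, ∫ x in normBall E R, e (B x x) ∂μ = I := by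
  have : ProperSpace E := FiniteDimensional.proper k E
  obtain ⟨ρ, R, h0, h1, hBρ, hd, hR⟩ := exists_ballDual_subset B h2 hnd
  have h3 : ∀ R' ≥ R, ∫ x in normBall E R', e (B x x) ∂μ = ∫ x in ballDual B ρ, e (B x x) ∂μ :=
    fun R' hR' => setIntegral_quadratic_stable μ he B hB h0 hBρ _ (normBall_measurable _)
      (normBall_ne_top _ _) (normBall_mono (h1.trans hR'))
      (hd.trans fun x (hx : ‖x‖ ≤ R) => hx.trans (NNReal.coe_le_coe.2 hR'))
  refine ⟨_, ?_, R, h3⟩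
  rw [← h3 R le_rfl]
  exact setIntegral_ball_ne_zero μ he B hB hBρ (hR R le_rfl) (h0.trans_le h1)
end

end

section
open MeasureTheory Metric

section
variable {k : Type} [NontriviallyNormedField k] [ProperSpace k]
variable {E : Type} [NormedAddCommGroup E] [NormedSpace k E] [FiniteDimensional k E]
variable [IsUltrametricDist E] [MeasurableSpace E] [BorelSpace E]

/-- The Gauss integrals of `e ∘ q` over large balls are positive multiples of `z`, with
`‖z‖ = 1`. -/
def HasPhase {k E : Type} [NormedAddCommGroup E] [IsUltrametricDist E] [MeasurableSpace E]
    (e : k → ℂ) (μ : Measure E) (q : E → k) (z : ℂ) : Prop :=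
  ‖z‖ = 1 ∧ ∃ c : ℝ, 0 < c ∧ ∃ R0 : NNReal, ∀ R ≥ R0, ∫ x in normBall E R, e (q x) ∂μ = c * z

theorem HasPhase.unique {k E : Type} [NormedAddCommGroup E] [IsUltrametricDist E]
    [MeasurableSpace E] {e : k → ℂ} {μ : Measure E} {q : E → k} {z w : ℂ}
    (hz : HasPhase e μ q z) (hw : HasPhase e μ q w) : z = w := by
  obtain ⟨hz1, c, hc, R, hR⟩ := hz
  obtain ⟨hw1, d, hd, S, hS⟩ := hw
  have h := (hR (max R S) (le_max_left _ _)).symm.trans (hS (max R S) (le_max_right _ _))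
  have h1 := congrArg norm h
  rw [norm_mul, norm_mul, hz1, hw1, mul_one, mul_one, Complex.norm_of_nonneg hc.le,
    Complex.norm_of_nonneg hd.le] at h1
  subst h1
  exact mul_left_cancel₀ (by exact_mod_cast hc.ne') h

theorem HasPhase.neg {k E : Type} [NontriviallyNormedField k] [NormedAddCommGroup E]
    [IsUltrametricDist E]
    [MeasurableSpace E] {e : k → ℂ} (he : IsStdChar e) {μ : Measure E} {q : E → k} {z : ℂ}
    (hz : HasPhase e μ q z) : HasPhase e μ (fun x => -q x) ((starRingEnd ℂ) z) := by
  obtain ⟨hz1, c, hc, R, hR⟩ := hz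
  refine ⟨by simpa using hz1, c, hc, R, fun S hS => ?_⟩
  simp only [he.neg]
  rw [integral_conj, hR S hS]
  simp

theorem exists_hasPhase (μ : Measure E) [μ.IsAddHaarMeasure] (h2 : (2 : k) ≠ 0)
    {e : k → ℂ} (he : IsStdChar e) (B : LinearMap.BilinForm k E) (hB : ∀ x y, B x y = B y x)
    (hnd : ∀ x, (∀ y, B x y = 0) → x = 0) : ∃ z, HasPhase e μ (fun x => B x x) z := by
  obtain ⟨I, hI, R0, hR⟩ := exists_phase μ h2 he B hB hnd
  have hn : 0 < ‖I‖ := norm_pos_iff.2 hI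
  refine ⟨I / ‖I‖, by simp [hI], ‖I‖, hn, R0, fun R h => ?_⟩
  have hn' : (‖I‖ : ℂ) ≠ 0 := by exact_mod_cast hn.ne'
  rw [hR R h, mul_div_cancel₀ _ hn']
end

section
variable {k : Type} [NontriviallyNormedField k] [ProperSpace k] [IsUltrametricDist k]
  [MeasurableSpace k] [BorelSpace k]
variable {ι : Type} [Fintype ι]

/-- The diagonal bilinear form with entries `a`. -/
def diagForm {k ι : Type} [Field k] [Fintype ι] (a : ι → k) : LinearMap.BilinForm k (ι → k) :=
  LinearMap.mk₂ k (fun x y => ∑ i, a i * (x i * y i))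
    (fun x x' y => by simp only [Pi.add_apply, add_mul, mul_add, Finset.sum_add_distrib])
    (fun c x y => by
      simp only [Pi.smul_apply, smul_eq_mul, Finset.mul_sum]
      exact Finset.sum_congr rfl fun _ _ => by ring)
    (fun x y y' => by simp only [Pi.add_apply, mul_add, Finset.sum_add_distrib])
    (fun c x y => by
      simp only [Pi.smul_apply, smul_eq_mul, Finset.mul_sum]
      exact Finset.sum_congr rfl fun _ _ => by ring)

@[simp] theorem diagForm_apply {k ι : Type} [Field k] [Fintype ι] (a x y : ι → k) :
    diagForm a x y = ∑ i, a i * (x i * y i) := rfl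

theorem diagForm_symm {k ι : Type} [Field k] [Fintype ι] (a x y : ι → k) :
    diagForm a x y = diagForm a y x := by
  simp only [diagForm_apply, mul_comm]

theorem diagForm_nondeg {k ι : Type} [Field k] [Fintype ι] {a : ι → k} (ha : ∀ i, a i ≠ 0)
    (x : ι → k) (h : ∀ y, diagForm a x y = 0) : x = 0 := by
  classical
  ext i
  have := h (Pi.single i 1)
  simp only [diagForm_apply, Pi.single_apply, mul_ite, mul_one, mul_zero, Finset.sum_ite_eq',
    Finset.mem_univ, if_true] at this
  simpa [ha i] using this

omit [BorelSpace k] in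
theorem hasPhase_diagForm (μ₀ : Measure k) [μ₀.IsAddHaarMeasure] {e : k → ℂ} (he : IsStdChar e)
    (a : ι → k) (z : ι → ℂ) (hz : ∀ i, HasPhase e μ₀ (fun x => a i * (x * x)) (z i)) :
    HasPhase e (Measure.pi fun _ : ι => μ₀) (fun x => diagForm a x x) (∏ i, z i) := by
  refine ⟨by rw [norm_prod]; exact Finset.prod_eq_one fun i _ => (hz i).1, ?_⟩
  choose h1 c hc R0 hR using hz
  refine ⟨∏ i, c i, Finset.prod_pos fun i _ => hc i, Finset.univ.sup R0, fun R h => ?_⟩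
  have hX : (normBall (ι → k) R : Set (ι → k)) = Set.univ.pi fun _ => (normBall k R : Set k) := by
    simp only [coe_normBall]
    exact closedBall_pi (0 : ι → k) R.2
  rw [hX, Measure.restrict_pi_pi]
  simp only [diagForm_apply, he.sum]
  rw [integral_fintype_prod_eq_prod (fun i x => e (a i * (x * x))),
    Finset.prod_congr rfl fun i _ => hR i R ((Finset.le_sup (Finset.mem_univ i)).trans h),
    Finset.prod_mul_distrib]
  simp

omit [IsUltrametricDist k] [MeasurableSpace k] [BorelSpace k] in
theorem hasPhase_of_equiv {E : Type} [NormedAddCommGroup E] [NormedSpace k E]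
    [FiniteDimensional k E] [IsUltrametricDist E] [MeasurableSpace E] [BorelSpace E]
    (μ : Measure E) [μ.IsAddHaarMeasure] (h2 : (2 : k) ≠ 0) {e : k → ℂ} (he : IsStdChar e)
    (L : E ≃ₗ[k] E) (B D : LinearMap.BilinForm k E) (hB : ∀ x y, D x y = D y x)
    (hnd : ∀ x, (∀ y, D x y = 0) → x = 0)
    (hL : ∀ x y, B (L x) (L y) = D x y) {z : ℂ} (hz : HasPhase e μ (fun x => D x x) z) :
    HasPhase e μ (fun x => B x x) z := by
  have : ProperSpace E := FiniteDimensional.proper k E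
  have : SecondCountableTopology E := secondCountable_of_proper
  obtain ⟨hz1, c, hc, S, hS⟩ := hz
  refine ⟨hz1, ?_⟩
  let L' : E ≃L[k] E := L.toContinuousLinearEquiv
  have hL' : ∀ x, L' x = L x := fun _ => rfl
  have hH : (μ.map L').IsAddHaarMeasure := L'.isAddHaarMeasure_map μ
  set s := μ.addHaarScalarFactor (μ.map L') with hs
  have hs0 : 0 < s := Measure.addHaarScalarFactor_pos_of_isAddHaarMeasure _ _
  have hμ : μ = s • μ.map L' := Measure.isAddLeftInvariant_eq_smul _ _
  obtain ⟨ρ, R, h0, h1, hBρ, hd, -⟩ := exists_ballDual_subset D h2 hnd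
  obtain ⟨C, hC⟩ : ∃ C : NNReal, ∀ x, ‖L x‖ ≤ C * ‖x‖ :=
    ⟨‖(L' : E →L[k] E)‖₊, fun x => (L' : E →L[k] E).le_opNorm x⟩
  refine ⟨s * c, by positivity, C * R, fun T hT => ?_⟩
  have hX : ∀ x ∈ normBall E R, x ∈ (normBall E T).comap L.toLinearMap.toAddMonoidHom := by
    intro x hx
    show ‖L x‖ ≤ T
    refine (hC x).trans ?_
    have : ‖x‖ ≤ R := hx
    calc (C : ℝ) * ‖x‖ ≤ C * R := by gcongr
      _ ≤ T := by exact_mod_cast hT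
  have hpre : (L' ⁻¹' (normBall E T : Set E)) =
      ((normBall E T).comap L.toLinearMap.toAddMonoidHom : AddSubgroup E) := rfl
  have hst : ∫ x in (normBall E T).comap L.toLinearMap.toAddMonoidHom, e (D x x) ∂μ =
      ∫ x in ballDual D ρ, e (D x x) ∂μ := by
    refine setIntegral_quadratic_stable μ he D hB h0 hBρ _ ?_ ?_
      (fun x hx => hX x (normBall_mono h1 hx)) (hd.trans hX)
    · rw [← hpre]; exact L'.continuous.measurable (normBall_measurable T)
    · rw [← hpre, coe_normBall]
      exact (L'.toHomeomorph.isClosedEmbedding.isCompact_preimage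
        (isCompact_closedBall _ _)).measure_lt_top.ne
  have hst' := setIntegral_quadratic_stable μ he D hB h0 hBρ _ (normBall_measurable (max R S))
      (normBall_ne_top _ _) (normBall_mono (h1.trans (le_max_left _ _)))
      (hd.trans fun x (hx : ‖x‖ ≤ R) => hx.trans (NNReal.coe_le_coe.2 (le_max_left _ _)))
  have hmp : ∫ x in normBall E T, e (B x x) ∂(μ.map L') =
      ∫ x in (normBall E T).comap L.toLinearMap.toAddMonoidHom, e (D x x) ∂μ := by
    have := L'.toHomeomorph.measurableEmbedding.setIntegral_map (μ := μ)
      (fun x => e (B x x)) (normBall E T)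
    refine this.trans ?_
    simp only [← hL]
    rfl
  rw [hμ, Measure.restrict_smul, integral_smul_nnreal_measure, hmp, hst, ← hst',
    hS _ (le_max_right _ _)]
  simp [NNReal.smul_def, mul_assoc]
end

end

section
open MeasureTheory Metric

section
variable {k : Type} [NontriviallyNormedField k] [ProperSpace k] [IsUltrametricDist k]
  [MeasurableSpace k] [BorelSpace k]
variable {ι : Type} [Fintype ι]

open scoped Pointwise

theorem distribHaarChar_pi (g : kˣ) :
    distribHaarChar (ι → k) g = (distribHaarChar k g) ^ Fintype.card ι := by
  let μ₀ : Measure k := Measure.addHaar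
  let B : Set k := closedBall 0 1
  have hB0 : μ₀ B ≠ 0 := (measure_closedBall_pos μ₀ 0 one_pos).ne'
  have hB1 : μ₀ B ≠ ⊤ := (isCompact_closedBall _ _).measure_lt_top.ne
  refine distribHaarChar_eq_of_measure_smul_eq_mul (μ := Measure.pi fun _ : ι => μ₀)
    (s := Set.univ.pi fun _ => B) ?_ ?_ ?_
  · rw [Measure.pi_pi]; exact Finset.prod_ne_zero_iff.2 fun _ _ => hB0
  · rw [Measure.pi_pi]; exact ENNReal.prod_ne_top fun _ _ => hB1
  · have : g • (Set.univ.pi fun _ : ι => B) = Set.univ.pi fun _ : ι => g • B := by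
      ext x
      simp only [Set.mem_smul_set_iff_inv_smul_mem, Set.mem_univ_pi, Pi.smul_apply]
    rw [this, Measure.pi_pi, Measure.pi_pi]
    simp only [← distribHaarChar_mul, Finset.prod_const, Finset.card_univ, mul_pow]
    push_cast
    rfl

theorem distribHaarChar_lt_one (g : kˣ) (hg : ‖(g : k)‖ < 1) : distribHaarChar k g < 1 := by
  let μ₀ : Measure k := Measure.addHaar
  let B : Set k := closedBall 0 1
  have hB0 : μ₀ B ≠ 0 := (measure_closedBall_pos μ₀ 0 one_pos).ne'
  have hB1 : μ₀ B ≠ ⊤ := (isCompact_closedBall _ _).measure_lt_top.ne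
  have hg0 : 0 < ‖(g : k)‖ := norm_pos_iff.2 g.ne_zero
  have hgB : g • B = closedBall 0 ‖(g : k)‖ := by
    ext x
    rw [Set.mem_smul_set_iff_inv_smul_mem, Units.smul_def, mem_closedBall_zero_iff,
      mem_closedBall_zero_iff, norm_smul, Units.val_inv_eq_inv_val, norm_inv,
      inv_mul_le_iff₀ hg0, mul_one]
  have h : μ₀ (g • B) < μ₀ B := by
    have hsub : g • B ⊆ B := by rw [hgB]; exact closedBall_subset_closedBall hg.le
    have hm : MeasurableSet (g • B) := by rw [hgB]; exact isClosed_closedBall.measurableSet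
    have ho : IsOpen (B \ g • B) := by
      rw [hgB]
      exact (IsUltrametricDist.isOpen_closedBall _ one_ne_zero).sdiff isClosed_closedBall
    have h1 : 0 < μ₀ (B \ g • B) := ho.measure_pos _ ⟨1, by simp [B], by
      rw [hgB]; simpa using hg⟩
    rw [← measure_sdiff_add_inter B hm, Set.inter_eq_self_of_subset_right hsub, add_comm]
    exact ENNReal.lt_add_right (measure_ne_top_of_subset hsub hB1) h1.ne'
  rw [← distribHaarChar_mul] at h
  by_contra! h'
  refine absurd h (not_lt.2 ?_)
  calc μ₀ B = 1 * μ₀ B := (one_mul _).symm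
    _ ≤ _ := by gcongr; exact_mod_cast h'
end

section
variable {k : Type} [NontriviallyNormedField k] [ProperSpace k] [IsUltrametricDist k]
variable {W E : Type} [NormedAddCommGroup E] [NormedSpace k E] [FiniteDimensional k E]
  [NormedAddCommGroup W] [NormedSpace k W] [FiniteDimensional k W]

/-- The points at which all members of the family `β` indexed by the ball of radius `c` are
integral. -/
def integralLocus (β : W →ₗ[k] LinearMap.BilinForm k E) (c : NNReal) : Set E :=
  {x | ∀ w, ‖w‖ ≤ c → ‖β w x x‖ ≤ 1}

omit [IsUltrametricDist k] in
theorem exists_integralLocus_subset (β : W →ₗ[k] LinearMap.BilinForm k E)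
    (hβ : ∀ x, x ≠ 0 → ∃ w, β w x x ≠ 0) {c : NNReal} (hc : 0 < c) :
    ∃ R : NNReal, integralLocus β c ⊆ {x | ‖x‖ ≤ R} := by
  have hcont := continuous_trilinear β
  let b := Module.finBasis k W
  obtain ⟨a, ha0, ha⟩ := NormedField.exists_norm_lt k (r := c / (∑ i, ‖b i‖ + 1)) (by positivity)
  obtain ⟨δ, hδ, h⟩ := exists_pos_le_of_homogeneous (k := k) (E := E)
    (isCompact_singleton (x := ())) (fun _ x => ∑ i, ‖β (b i) x x‖)
    (by
      refine continuous_finsetSum _ fun i _ => Continuous.norm ?_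
      exact hcont.comp (by fun_prop : Continuous fun p : Unit × E => (b i, p.2, p.2)))
    (d := 2) two_ne_zero
    (fun _ t x => by
      rw [Finset.mul_sum]
      refine Finset.sum_congr rfl fun i _ => ?_
      rw [map_smul, map_smul, LinearMap.smul_apply, smul_eq_mul, smul_eq_mul, norm_mul, norm_mul]
      ring)
    (fun _ _ x hx => by
      obtain ⟨w, hw⟩ := hβ x hx
      obtain ⟨i, hi⟩ : ∃ i, β (b i) x x ≠ 0 := by
        by_contra! h
        refine hw ?_
        rw [← b.sum_repr w, map_sum, LinearMap.sum_apply, LinearMap.sum_apply]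
        exact Finset.sum_eq_zero fun i _ => by simp [h]
      exact Finset.sum_pos' (fun i _ => norm_nonneg _) ⟨i, Finset.mem_univ _, norm_pos_iff.2 hi⟩)
  set n : ℝ := (Fintype.card (Fin (Module.finrank k W)) : ℝ) with hn
  refine ⟨⟨n / (δ * ‖a‖) + 1, by positivity⟩, fun x hx => ?_⟩
  show ‖x‖ ≤ n / (δ * ‖a‖) + 1
  have h1 : δ * ‖x‖ ^ 2 ≤ n * ‖a‖⁻¹ := by
    refine (h () rfl x).trans ?_
    refine (Finset.sum_le_card_nsmul _ _ (‖a‖⁻¹) fun i _ => ?_).trans (by simp [hn])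
    have := hx (a • b i) (by
      rw [norm_smul]
      rw [lt_div_iff₀ (by positivity)] at ha
      refine le_trans ?_ ha.le
      gcongr
      have := Finset.single_le_sum (f := fun i => ‖b i‖) (fun i _ => norm_nonneg _)
        (Finset.mem_univ i)
      linarith)
    rw [map_smul, LinearMap.smul_apply, LinearMap.smul_apply, norm_smul] at this
    rwa [← one_div, le_div_iff₀' ha0]
  have h2 : ‖x‖ ^ 2 ≤ n / (δ * ‖a‖) := by
    rw [le_div_iff₀ (by positivity)]
    calc ‖x‖ ^ 2 * (δ * ‖a‖) = (δ * ‖x‖ ^ 2) * ‖a‖ := by ring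
      _ ≤ n * ‖a‖⁻¹ * ‖a‖ := by gcongr
      _ = n := by rw [inv_mul_cancel_right₀ ha0.ne']
  nlinarith [sq_nonneg (‖x‖ - 1), norm_nonneg x]

omit [ProperSpace k] [IsUltrametricDist k] [FiniteDimensional k E] [FiniteDimensional k W] in
theorem integralLocus_mul (β : W →ₗ[k] LinearMap.BilinForm k E) (g : kˣ) :
    integralLocus β (‖(g : k)‖₊ ^ 2) = {x | (g : k) • x ∈ integralLocus β 1} := by
  ext x
  constructor
  · intro h w hw
    have := h (((g : k) ^ 2) • w) (by
      rw [norm_smul, norm_pow]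
      push_cast
      exact mul_le_of_le_one_right (by positivity) hw)
    simp only [map_smul, LinearMap.smul_apply, smul_eq_mul] at this ⊢
    rwa [sq, mul_assoc] at this
  · intro h w hw
    have hg0 : (0:ℝ) < ‖(g : k)‖ := norm_pos_iff.2 g.ne_zero
    have := h ((((g : k) ^ 2)⁻¹) • w) (by
      rw [norm_smul, norm_inv, norm_pow, inv_mul_le_iff₀ (by positivity)]
      simpa using hw)
    simp only [map_smul, LinearMap.smul_apply, smul_eq_mul] at this ⊢
    have h2 : (g : k) * ((g : k) * ((((g : k) ^ 2)⁻¹) * β w x x)) = β w x x := by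
      have := g.ne_zero
      field_simp
    rwa [h2] at this

variable [IsUltrametricDist W] [MeasurableSpace W] [BorelSpace W]
  [IsUltrametricDist E] [MeasurableSpace E] [BorelSpace E]

omit [IsUltrametricDist k] in
theorem integral_family_eq (β : W →ₗ[k] LinearMap.BilinForm k E)
    (μ : Measure E) [μ.IsAddHaarMeasure] (ν : Measure W) [ν.IsAddHaarMeasure]
    {e : k → ℂ} (he : IsStdChar e) {c R : NNReal} (hR : integralLocus β c ⊆ {x | ‖x‖ ≤ R}) :
    IntegrableOn (fun w => ∫ x in normBall E R, e (β w x x) ∂μ) (normBall W c) ν ∧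
    ∫ w in normBall W c, ∫ x in normBall E R, e (β w x x) ∂μ ∂ν =
      ((ν.real (normBall W c) * μ.real (integralLocus β c) : ℝ) : ℂ) := by
  have : ProperSpace E := FiniteDimensional.proper k E
  have : ProperSpace W := FiniteDimensional.proper k W
  have hβ : Continuous fun p : W × E => β p.1 p.2 p.2 :=
    (continuous_trilinear β).comp (by fun_prop : Continuous fun p : W × E => (p.1, p.2, p.2))
  have hW := normBall_measurable (E := W) c
  have f1 : IsFiniteMeasure (μ.restrict (normBall E R)) :=
    ⟨by simpa using (normBall_ne_top μ R).lt_top⟩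
  have f2 : IsFiniteMeasure (ν.restrict (normBall W c)) :=
    ⟨by simpa using (normBall_ne_top ν c).lt_top⟩
  have hint : Integrable (Function.uncurry fun (w : W) (x : E) => e (β w x x))
      ((ν.restrict (normBall W c)).prod (μ.restrict (normBall E R))) := by
    apply Integrable.of_bound (C := 1)
    · exact (he.cont.comp hβ).aestronglyMeasurable
    · exact Filter.Eventually.of_forall fun p => (he.norm _).le
  refine ⟨hint.integral_prod_left, ?_⟩
  rw [integral_integral_swap hint]
  have hZ : MeasurableSet (integralLocus β c) := by
    simp only [integralLocus, Set.ofPred_forall]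
    refine (isClosed_iInter fun w => isClosed_iInter fun _ =>
      isClosed_le ?_ continuous_const).measurableSet
    exact (hβ.comp (by fun_prop : Continuous fun x : E => (w, x))).norm
  have h1 : ∀ x, ∫ w in normBall W c, e (β w x x) ∂ν =
      (integralLocus β c).indicator (fun _ => (ν.real (normBall W c) : ℂ)) x := by
    intro x
    rw [setIntegral_addSubgroup_character ν _ hW (fun w => e (β w x x))
      (fun w _ w' _ => by rw [map_add, LinearMap.add_apply, LinearMap.add_apply, he.add])]
    by_cases hx : x ∈ integralLocus β c
    · rw [if_pos (show ∀ w ∈ normBall W c, e (β w x x) = 1 from fun w hw => he.triv _ (hx w hw)),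
        Set.indicator_of_mem hx]
    · rw [if_neg, Set.indicator_of_notMem hx]
      intro h
      refine hx fun w hw => he.cond _ fun a ha => ?_
      have := h (a • w) (by
        rw [mem_normBall, norm_smul]
        exact (mul_le_of_le_one_left (norm_nonneg _) ha).trans hw)
      rwa [map_smul] at this
  simp only [h1]
  rw [setIntegral_indicator hZ, show (normBall E R : Set E) ∩ integralLocus β c = integralLocus β c from
    Set.inter_eq_self_of_subset_right hR]
  simp [Measure.real, mul_comm]
end

section
variable {k : Type} [NontriviallyNormedField k] [ProperSpace k] [IsUltrametricDist k]
  [MeasurableSpace k] [BorelSpace k]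
variable {ι κ : Type} [Fintype ι] [Fintype κ]

open scoped Pointwise

/-- A family of forms all having the same phase, averaged over the parameter. -/
theorem exists_pos_phase_integral [Nonempty κ] (μ₀ : Measure k) [μ₀.IsAddHaarMeasure]
    (h2 : (2 : k) ≠ 0) {e : k → ℂ} (he : IsStdChar e)
    (β : (κ → k) →ₗ[k] LinearMap.BilinForm k (ι → k)) (hsymm : ∀ w x y, β w x y = β w y x)
    (hnd : ∀ w, w ≠ 0 → ∀ x, (∀ y, β w x y = 0) → x = 0) {z : ℂ}
    (hz : ∀ w, w ≠ 0 → HasPhase e (Measure.pi fun _ : ι => μ₀) (fun x => β w x x) z)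
    {c : NNReal} (hc0 : 0 < c) (hc : c < 1) :
    ∃ R0 : NNReal, ∀ R ≥ R0, ∃ J : ℝ, 0 < J ∧
      (IntegrableOn (fun w => ∫ x in normBall (ι → k) R, e (β w x x) ∂(Measure.pi fun _ => μ₀))
        (normBall (κ → k) 1) (Measure.pi fun _ => μ₀) →
      ∫ w in (normBall (κ → k) 1 : Set (κ → k)) \ normBall (κ → k) c,
        ∫ x in normBall (ι → k) R, e (β w x x) ∂(Measure.pi fun _ => μ₀)
        ∂(Measure.pi fun _ => μ₀) = J * z) := by
  set μ : Measure (ι → k) := Measure.pi fun _ => μ₀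
  set ν : Measure (κ → k) := Measure.pi fun _ => μ₀
  set S : Set (κ → k) := (normBall (κ → k) 1 : Set (κ → k)) \ normBall (κ → k) c with hS
  have hSo : IsOpen S := by
    rw [hS, coe_normBall, coe_normBall]
    exact (IsUltrametricDist.isOpen_closedBall _ (by simp)).sdiff isClosed_closedBall
  have hSc : IsCompact S := by
    rw [hS, coe_normBall, coe_normBall]
    exact (isCompact_closedBall _ _).diff
      (IsUltrametricDist.isOpen_closedBall _ (by exact_mod_cast hc0.ne'))
  have hS0 : ∀ w ∈ S, w ≠ 0 := by
    rintro w hw rfl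
    exact hw.2 (zero_mem _)
  have hSne : S.Nonempty := by
    refine ⟨fun _ => 1, ?_, fun h => ?_⟩
    · show ‖(fun _ => 1 : κ → k)‖ ≤ 1
      rw [pi_norm_const, norm_one]
    · have : ‖(fun _ => 1 : κ → k)‖ ≤ c := h
      rw [pi_norm_const, norm_one] at this
      exact absurd (by exact_mod_cast this : (1 : NNReal) ≤ c) (not_le.2 hc)
  obtain ⟨ρ, R0, h0, h1, hβρ, hd⟩ := exists_ball_uniform β hSc h2 fun w hw => hnd w (hS0 w hw)
  refine ⟨R0, fun R hR => ?_⟩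
  set F : (κ → k) → ℂ := fun w => ∫ x in normBall (ι → k) R, e (β w x x) ∂μ with hF
  have key : ∀ w ∈ S, 0 < ‖F w‖ ∧ F w = ‖F w‖ * z := by
    intro w hw
    obtain ⟨hz1, d, hd0, R1, hR1⟩ := hz w (hS0 w hw)
    have hst : ∀ T ≥ R0, ∫ x in normBall (ι → k) T, e (β w x x) ∂μ =
        ∫ x in ballDual (β w) ρ, e (β w x x) ∂μ := fun T hT =>
      setIntegral_quadratic_stable μ he (β w) (hsymm w) h0 (hβρ w hw) _ (normBall_measurable T)
        (normBall_ne_top _ _) (normBall_mono (h1.trans hT))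
        ((hd w hw).trans fun x (hx : ‖x‖ ≤ R0) => hx.trans (NNReal.coe_le_coe.2 hT))
    have : F w = d * z := by
      rw [hF]
      simp only
      rw [hst R hR, ← hst (max R0 R1) (le_max_left _ _), hR1 _ (le_max_right _ _)]
    have hn : ‖F w‖ = d := by rw [this, norm_mul, hz1, mul_one, Complex.norm_of_nonneg hd0.le]
    rw [hn]
    exact ⟨hd0, this⟩
  by_cases hint : IntegrableOn F (normBall (κ → k) 1) ν
  · have hintS : IntegrableOn (fun w => ‖F w‖) S ν := (hint.mono_set Set.sdiff_subset).norm
    refine ⟨∫ w in S, ‖F w‖ ∂ν, ?_, fun _ => ?_⟩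
    · rw [setIntegral_pos_iff_support_of_nonneg_ae
        (Filter.Eventually.of_forall fun _ => norm_nonneg _) hintS]
      rw [show (Function.support fun x => ‖F x‖) ∩ S = S from
        Set.inter_eq_self_of_subset_right fun w hw => (key w hw).1.ne']
      exact hSo.measure_pos _ hSne
    · rw [← integral_complex_ofReal, ← integral_mul_const]
      exact setIntegral_congr_fun hSo.measurableSet fun w hw => (key w hw).2
  · exact ⟨1, one_pos, fun h => absurd h hint⟩

/-- If all nonzero members of a linear family of forms have the same phase, then the number of
variables is not twice the number of parameters, and if it is larger then the phase is `-1`. -/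
theorem phase_constraint [Nonempty κ] (μ₀ : Measure k) [μ₀.IsAddHaarMeasure]
    (h2 : (2 : k) ≠ 0) {e : k → ℂ} (he : IsStdChar e)
    (β : (κ → k) →ₗ[k] LinearMap.BilinForm k (ι → k)) (hsymm : ∀ w x y, β w x y = β w y x)
    (hnd : ∀ w, w ≠ 0 → ∀ x, (∀ y, β w x y = 0) → x = 0)
    (haniso : ∀ x, x ≠ 0 → ∃ w, β w x x ≠ 0) {z : ℂ}
    (hz : ∀ w, w ≠ 0 → HasPhase e (Measure.pi fun _ : ι => μ₀) (fun x => β w x x) z) :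
    Fintype.card ι ≠ 2 * Fintype.card κ ∧ (2 * Fintype.card κ < Fintype.card ι → z = -1) := by
  obtain ⟨p, hp0, hp1, -⟩ := exists_uniformizer_norm k
  let g : kˣ := Units.mk0 p hp0
  have hpn : 0 < ‖p‖₊ := nnnorm_pos.2 hp0
  have hc1 : ‖p‖₊ ^ 2 < 1 := pow_lt_one₀ hpn.le (by exact_mod_cast hp1) two_ne_zero
  have hc0 : 0 < ‖p‖₊ ^ 2 := by positivity
  set μ : Measure (ι → k) := Measure.pi fun _ => μ₀
  set ν : Measure (κ → k) := Measure.pi fun _ => μ₀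
  obtain ⟨R0, hR0⟩ := exists_pos_phase_integral μ₀ h2 he β hsymm hnd hz hc0 hc1
  obtain ⟨R1, hR1⟩ := exists_integralLocus_subset β haniso (c := 1) one_pos
  obtain ⟨R2, hR2⟩ := exists_integralLocus_subset β haniso hc0
  set R := max R0 (max R1 R2)
  obtain ⟨J, hJ0, hJ⟩ := hR0 R (le_max_left _ _)
  obtain ⟨hI1, hE1⟩ := integral_family_eq β μ ν he (c := 1) (R := R)
    (hR1.trans fun x (hx : ‖x‖ ≤ R1) => hx.trans
      (NNReal.coe_le_coe.2 ((le_max_left _ _).trans (le_max_right _ _))))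
  obtain ⟨-, hE2⟩ := integral_family_eq β μ ν he (R := R)
    (hR2.trans fun x (hx : ‖x‖ ≤ R2) => hx.trans
      (NNReal.coe_le_coe.2 ((le_max_right _ _).trans (le_max_right _ _))))
  have hdiff := integral_inter_add_sdiff (normBall_measurable (E := κ → k) (‖p‖₊ ^ 2)) hI1
  rw [Set.inter_eq_self_of_subset_right (normBall_mono hc1.le), hE1, hE2, hJ hI1] at hdiff
  set t : NNReal := distribHaarChar k g with ht
  have ht1 : t < 1 := distribHaarChar_lt_one g hp1
  have ht0 : 0 < t := distribHaarChar_pos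
  have hν : ν.real (normBall (κ → k) (‖p‖₊ ^ 2)) =
      t ^ (2 * Fintype.card κ) * ν.real (normBall (κ → k) 1) := by
    have : (normBall (κ → k) (‖p‖₊ ^ 2) : Set (κ → k)) = (g ^ 2) • (normBall (κ → k) 1 : Set _) := by
      ext x
      rw [Set.mem_smul_set_iff_inv_smul_mem, SetLike.mem_coe, SetLike.mem_coe, mem_normBall,
        mem_normBall, Units.smul_def, norm_smul, Units.val_inv_eq_inv_val, norm_inv,
        Units.val_pow_eq_pow_val, norm_pow, inv_mul_le_iff₀ (pow_pos (by exact_mod_cast hpn : (0 : ℝ) < ‖(g : k)‖) 2)]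
      simp [g]
    rw [Measure.real, Measure.real, this, ← distribHaarChar_mul, map_pow, distribHaarChar_pi,
      ← pow_mul, ENNReal.toReal_mul, ← ht, mul_comm (Fintype.card κ)]
    simp
  have hμ : μ.real (integralLocus β 1) =
      t ^ Fintype.card ι * μ.real (integralLocus β (‖p‖₊ ^ 2)) := by
    have : integralLocus β 1 = g • integralLocus β (‖p‖₊ ^ 2) := by
      have h := integralLocus_mul β g
      simp only [g, Units.val_mk0] at h
      rw [h]
      ext x
      rw [Set.mem_smul_set_iff_inv_smul_mem]
      simp [g, Units.smul_def, smul_smul, hp0]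
    rw [Measure.real, Measure.real, this, ← distribHaarChar_mul, distribHaarChar_pi,
      ENNReal.toReal_mul, ← ht]
    simp
  set A := ν.real (normBall (κ → k) 1) with hA
  set Z := μ.real (integralLocus β (‖p‖₊ ^ 2)) with hZ
  rw [hμ, hν] at hdiff
  have hdiff' : (J : ℂ) * z =
      ((A * Z * ((t : ℝ) ^ Fintype.card ι - (t : ℝ) ^ (2 * Fintype.card κ)) : ℝ) : ℂ) := by
    rw [eq_sub_of_add_eq' hdiff]
    push_cast
    ring
  obtain ⟨w0⟩ := ‹Nonempty κ›
  have hw0 : (fun _ => 1 : κ → k) ≠ 0 := fun h => one_ne_zero (congrFun h w0)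
  have hz1 : ‖z‖ = 1 := (hz _ hw0).1
  have hz0 : z ≠ 0 := by rintro rfl; simp at hz1
  have hAZ0 : 0 ≤ A * Z := mul_nonneg measureReal_nonneg measureReal_nonneg
  constructor
  · intro h
    rw [h, sub_self, mul_zero, Complex.ofReal_zero] at hdiff'
    exact mul_ne_zero (by exact_mod_cast hJ0.ne') hz0 hdiff'
  · intro h
    set D := A * Z * ((t : ℝ) ^ Fintype.card ι - (t : ℝ) ^ (2 * Fintype.card κ)) with hD
    have hD0 : D ≤ 0 := by
      refine mul_nonpos_of_nonneg_of_nonpos hAZ0 (sub_nonpos.2 ?_)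
      exact pow_le_pow_of_le_one t.2 (by exact_mod_cast ht1.le) h.le
    have hDJ : -D = J := by
      have := congrArg norm hdiff'
      rwa [norm_mul, hz1, mul_one, Complex.norm_of_nonneg hJ0.le, Complex.norm_real,
        Real.norm_of_nonpos hD0, eq_comm] at this
    have : D = -J := by linarith
    rw [this] at hdiff'
    push_cast at hdiff'
    refine mul_left_cancel₀ (by exact_mod_cast hJ0.ne' : (J : ℂ) ≠ 0) ?_
    rw [hdiff']; ring
end

end

section
open Metric

section
variable {k : Type} [NontriviallyNormedField k] [IsUltrametricDist k] [ProperSpace k]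

open scoped Valued NormedField

variable (k) in
theorem finite_residueField_of_proper : Finite 𝓀[k] := by
  have hc : CompactSpace 𝒪[k] := by
    have : (𝒪[k] : Set k) = closedBall 0 1 := by
      ext x; simp [Valued.integer.mem_iff]
    have h : IsCompact (𝒪[k] : Set k) := by
      rw [this]
      exact isCompact_closedBall _ _
    exact isCompact_iff_compactSpace.1 h
  let _ : (Valued.v : Valuation k NNReal).RankOne :=
    inferInstanceAs (Valuation.RankOne (NormedField.valuation (K := k)))
  exact (Valued.integer.compactSpace_iff_completeSpace_and_isDiscreteValuationRing_and_finite_residueField.1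
    hc).2.2

omit [ProperSpace k] in
theorem residue_eq_zero_iff_norm (x : 𝒪[k]) : IsLocalRing.residue 𝒪[k] x = 0 ↔ ‖(x : k)‖ < 1 := by
  rw [IsLocalRing.residue_eq_zero_iff, IsLocalRing.mem_maximalIdeal, mem_nonunits_iff,
    Valued.integer.isUnit_iff_norm_eq_one]
  exact ⟨fun h => lt_of_le_of_ne (Valued.integer.norm_le_one x) h, fun h => h.ne⟩

/-- A ternary quadratic form over a finite field has a nontrivial zero. -/
theorem exists_ternary_zero {F : Type} [Field F] [Finite F] (a b c d e f : F) :
    ∃ x y z : F, ¬ (x = 0 ∧ y = 0 ∧ z = 0) ∧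
      a * x ^ 2 + b * y ^ 2 + c * z ^ 2 + d * (x * y) + e * (x * z) + f * (y * z) = 0 := by
  classical
  have := Fintype.ofFinite F
  obtain ⟨p, hp⟩ := CharP.exists F
  have hpp : p.Prime := (CharP.char_is_prime_or_zero F p).resolve_right fun h => by
    subst h
    have := CharP.charP_to_charZero F
    exact (Infinite.not_finite (α := F)) inferInstance
  let Y : Fin 3 → MvPolynomial (Fin 3) F := MvPolynomial.X
  let P : MvPolynomial (Fin 3) F :=
    MvPolynomial.C a * Y 0 ^ 2 + MvPolynomial.C b * Y 1 ^ 2 + MvPolynomial.C c * Y 2 ^ 2 +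
    MvPolynomial.C d * (Y 0 * Y 1) + MvPolynomial.C e * (Y 0 * Y 2) +
    MvPolynomial.C f * (Y 1 * Y 2)
  have hP : ∀ v, MvPolynomial.eval v P = a * v 0 ^ 2 + b * v 1 ^ 2 + c * v 2 ^ 2 +
      d * (v 0 * v 1) + e * (v 0 * v 2) + f * (v 1 * v 2) := fun v => by simp [P, Y]
  have hd : P.totalDegree < Fintype.card (Fin 3) := by
    have h1 : ∀ (s : F) (i j : Fin 3),
        (MvPolynomial.C s * (MvPolynomial.X i * MvPolynomial.X j)).totalDegree ≤ 2 := by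
      intro s i j
      refine (MvPolynomial.totalDegree_mul _ _).trans ?_
      rw [MvPolynomial.totalDegree_C, zero_add]
      refine (MvPolynomial.totalDegree_mul _ _).trans ?_
      simp
    have h2 : P.totalDegree ≤ 2 := by
      simp only [P, sq]
      refine (MvPolynomial.totalDegree_add _ _).trans (max_le ?_ (h1 _ _ _))
      refine (MvPolynomial.totalDegree_add _ _).trans (max_le ?_ (h1 _ _ _))
      refine (MvPolynomial.totalDegree_add _ _).trans (max_le ?_ (h1 _ _ _))
      refine (MvPolynomial.totalDegree_add _ _).trans (max_le ?_ (h1 _ _ _))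
      exact (MvPolynomial.totalDegree_add _ _).trans (max_le (h1 _ _ _) (h1 _ _ _))
    simpa using Nat.lt_succ_of_le h2
  have hdvd := char_dvd_card_solutions p hd
  have hcard : 1 < Fintype.card {v : Fin 3 → F // MvPolynomial.eval v P = 0} := by
    refine lt_of_lt_of_le hpp.one_lt (Nat.le_of_dvd ?_ hdvd)
    exact Fintype.card_pos_iff.2 ⟨⟨0, by rw [hP]; simp⟩⟩
  obtain ⟨⟨v, hv⟩, hne⟩ := Fintype.exists_ne_of_one_lt_card hcard ⟨0, by rw [hP]; simp⟩
  refine ⟨v 0, v 1, v 2, fun h => hne ?_, by rw [← hP, hv]⟩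
  apply Subtype.ext
  funext i
  fin_cases i <;> simp [h]

theorem exists_ternary_small {a b c d e f : k} (ha : ‖a‖ ≤ 1) (hb : ‖b‖ ≤ 1) (hc : ‖c‖ ≤ 1)
    (hd : ‖d‖ ≤ 1) (he : ‖e‖ ≤ 1) (hf : ‖f‖ ≤ 1) :
    ∃ x y z : k, ‖x‖ ≤ 1 ∧ ‖y‖ ≤ 1 ∧ ‖z‖ ≤ 1 ∧ ¬ (‖x‖ < 1 ∧ ‖y‖ < 1 ∧ ‖z‖ < 1) ∧
      ‖a * x ^ 2 + b * y ^ 2 + c * z ^ 2 + d * (x * y) + e * (x * z) + f * (y * z)‖ < 1 := by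
  have := finite_residueField_of_proper k
  have hO : ∀ {x : k}, ‖x‖ ≤ 1 → ∃ x' : 𝒪[k], (x' : k) = x :=
    fun h => ⟨⟨_, Valued.integer.mem_iff.2 h⟩, rfl⟩
  obtain ⟨a, rfl⟩ := hO ha
  obtain ⟨b, rfl⟩ := hO hb
  obtain ⟨c, rfl⟩ := hO hc
  obtain ⟨d, rfl⟩ := hO hd
  obtain ⟨e, rfl⟩ := hO he
  obtain ⟨f, rfl⟩ := hO hf
  let r := IsLocalRing.residue 𝒪[k]
  have hr : Function.Surjective r := IsLocalRing.residue_surjective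
  obtain ⟨x, y, z, h0, h⟩ := exists_ternary_zero (r a) (r b) (r c) (r d) (r e) (r f)
  obtain ⟨x, rfl⟩ := hr x
  obtain ⟨y, rfl⟩ := hr y
  obtain ⟨z, rfl⟩ := hr z
  refine ⟨x, y, z, Valued.integer.norm_le_one x, Valued.integer.norm_le_one y,
    Valued.integer.norm_le_one z, ?_, ?_⟩
  · simpa only [r, residue_eq_zero_iff_norm] using h0
  · have : r (a * x ^ 2 + b * y ^ 2 + c * z ^ 2 + d * (x * y) + e * (x * z) + f * (y * z)) = 0 := by
      simpa only [map_add, map_mul, map_pow] using h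
    simpa using (residue_eq_zero_iff_norm _).1 this

/-- A special case of Hensel's lemma. -/
theorem exists_hensel_root {ε : k} (hε : ‖ε‖ < 1) : ∃ t : k, ε * t ^ 2 + t + 1 = 0 := by
  let f : k → k := fun t => -1 - ε * t ^ 2
  have hs : Set.MapsTo f (closedBall 0 1) (closedBall 0 1) := by
    intro t ht
    rw [mem_closedBall_zero_iff] at ht ⊢
    simp only [f]
    rw [sub_eq_add_neg]
    refine (IsUltrametricDist.norm_add_le_max _ _).trans (max_le (by simp) ?_)
    rw [norm_neg, norm_mul, norm_pow]
    exact mul_le_one₀ hε.le (by positivity) (pow_le_one₀ (norm_nonneg _) ht)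
  have hc : ContractingWith ‖ε‖₊ (hs.restrict f (closedBall 0 1) (closedBall 0 1)) := by
    refine ⟨by exact_mod_cast hε, LipschitzWith.of_dist_le_mul ?_⟩
    rintro ⟨s, hs'⟩ ⟨t, ht⟩
    rw [mem_closedBall_zero_iff] at hs' ht
    simp only [Subtype.dist_eq, Set.MapsTo.val_restrict_apply, dist_eq_norm, f]
    have : -1 - ε * s ^ 2 - (-1 - ε * t ^ 2) = ε * ((s + t) * (t - s)) := by ring
    rw [this, norm_mul, norm_mul, norm_sub_rev t s]
    refine mul_le_mul_of_nonneg_left ?_ (norm_nonneg _)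
    exact mul_le_of_le_one_left (norm_nonneg _)
      ((IsUltrametricDist.norm_add_le_max _ _).trans (max_le hs' ht))
  obtain ⟨t, -, ht, -⟩ := hc.exists_fixedPoint' (isCompact_closedBall (0 : k) 1).isComplete hs
    (mem_closedBall_self zero_le_one) (edist_ne_top _ _)
  refine ⟨t, ?_⟩
  have : -1 - ε * t ^ 2 = t := ht
  linear_combination -this
end

section
variable {k : Type} [NontriviallyNormedField k] [IsUltrametricDist k] [ProperSpace k]
variable {V : Type} [AddCommGroup V] [Module k V]

theorem norm_polar_sq_le (B : LinearMap.BilinForm k V) (hB : ∀ x y, B x y = B y x)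
    (han : ∀ x, B x x = 0 → x = 0) (x y : V) :
    ‖2 * B x y‖ ^ 2 ≤ ‖B x x‖ * ‖B y y‖ := by
  by_contra! h
  obtain ⟨b, hb⟩ : ∃ b, b = 2 * B x y := ⟨_, rfl⟩
  rw [← hb] at h
  have hb0 : b ≠ 0 := by
    rintro h0
    rw [h0, norm_zero] at h
    rw [zero_pow two_ne_zero] at h
    exact absurd h (not_lt.2 (by positivity))
  have hε : ‖B x x * B y y / b ^ 2‖ < 1 := by
    rw [norm_div, norm_mul, norm_pow, div_lt_one (by positivity)]
    exact h
  obtain ⟨t, ht⟩ := exists_hensel_root hε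
  have h1 : B ((B y y / b * t) • x + y) ((B y y / b * t) • x + y) = 0 := by
    have : B ((B y y / b * t) • x + y) ((B y y / b * t) • x + y) =
        B y y * (B x x * B y y / b ^ 2 * t ^ 2 + t + 1) := by
      simp only [map_add, map_smul, LinearMap.add_apply, LinearMap.smul_apply, smul_eq_mul,
        hB y x]
      have h3 : B y y / b * t * B x y + B y y / b * t * B x y = B y y * t := by
        rw [← two_mul, show 2 * (B y y / b * t * B x y) = B y y / b * t * b by
          linear_combination -(B y y / b * t) * hb]
        field_simp
      have h4 : (B y y / b * t) * ((B y y / b * t) * B x x) =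
          B y y * (B x x * B y y / b ^ 2 * t ^ 2) := by ring
      linear_combination h3 + h4
    rw [this, ht, mul_zero]
  have h2 := han _ h1
  rw [add_eq_zero_iff_neg_eq] at h2
  set s := B y y / b * t
  have h3 : b ^ 2 = 4 * (B x x * B y y) := by
    rw [hb, ← h2]
    generalize s = s
    simp only [map_neg, map_smul, LinearMap.neg_apply, LinearMap.smul_apply, smul_eq_mul]
    ring
  have h4 : ‖(4 : k)‖ ≤ 1 := by
    exact_mod_cast IsUltrametricDist.norm_natCast_le_one k 4
  have h5 := congrArg norm h3
  rw [norm_pow, norm_mul, norm_mul] at h5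
  rw [h5] at h
  exact absurd h (not_lt.2 (mul_le_of_le_one_left (by positivity) h4))

theorem norm_form_add_le (B : LinearMap.BilinForm k V) (hB : ∀ x y, B x y = B y x)
    (han : ∀ x, B x x = 0 → x = 0) {r : ℝ} {x y : V} (hx : ‖B x x‖ ≤ r) (hy : ‖B y y‖ ≤ r) :
    ‖2 * B x y‖ ≤ r ∧ ‖B (x + y) (x + y)‖ ≤ r := by
  have hr : 0 ≤ r := (norm_nonneg _).trans hx
  have h1 : ‖2 * B x y‖ ≤ r := by
    refine abs_le_of_sq_le_sq' ?_ hr |>.2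
    refine (norm_polar_sq_le B hB han x y).trans ?_
    rw [sq]
    gcongr
  refine ⟨h1, ?_⟩
  have h2 : B (x + y) (x + y) = B x x + 2 * B x y + B y y := by
    simp only [map_add, LinearMap.add_apply, hB y x]; ring
  rw [h2]
  exact (IsUltrametricDist.norm_add_le_max _ _).trans
    (max_le ((IsUltrametricDist.norm_add_le_max _ _).trans (max_le hx h1)) hy)

/-- The lattice of vectors of value at most `r` for an anisotropic form. -/
def valueBall (B : LinearMap.BilinForm k V) (hB : ∀ x y, B x y = B y x)
    (han : ∀ x, B x x = 0 → x = 0) (r : NNReal) : AddSubgroup V where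
  carrier := {x | ‖B x x‖ ≤ r}
  zero_mem' := by simp
  add_mem' hx hy := (norm_form_add_le B hB han hx hy).2
  neg_mem' := by simp

variable {B : LinearMap.BilinForm k V} {hB : ∀ x y, B x y = B y x}
    {han : ∀ x, B x x = 0 → x = 0}

theorem mem_valueBall {r : NNReal} {x : V} : x ∈ valueBall B hB han r ↔ ‖B x x‖ ≤ r := Iff.rfl

theorem smul_mem_valueBall {r : NNReal} {x : V} (c : k) (hx : x ∈ valueBall B hB han r) :
    c • x ∈ valueBall B hB han (‖c‖₊ ^ 2 * r) := by
  rw [mem_valueBall] at hx ⊢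
  simp only [map_smul, LinearMap.smul_apply, smul_eq_mul, norm_mul]
  push_cast
  calc ‖c‖ * (‖c‖ * ‖B x x‖) ≤ ‖c‖ * (‖c‖ * r) := by gcongr
    _ = _ := by ring

theorem smul_mem_valueBall_of_le {r : NNReal} {x : V} {c : k} (hc : ‖c‖ ≤ 1)
    (hx : x ∈ valueBall B hB han r) : c • x ∈ valueBall B hB han r := by
  have := smul_mem_valueBall c hx
  rw [mem_valueBall] at this ⊢
  refine this.trans ?_
  push_cast
  exact mul_le_of_le_one_left r.2 (pow_le_one₀ (norm_nonneg _) hc)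

theorem exists_relation_valueBall {p : k} (hp0 : p ≠ 0) (hp : ∀ x : k, ‖x‖ < 1 → ‖x‖ ≤ ‖p‖) (i : ℕ)
    {x y z : V} (hx : x ∈ valueBall B hB han (‖p‖₊ ^ i)) (hy : y ∈ valueBall B hB han (‖p‖₊ ^ i))
    (hz : z ∈ valueBall B hB han (‖p‖₊ ^ i)) :
    ∃ a b c : k, ‖a‖ ≤ 1 ∧ ‖b‖ ≤ 1 ∧ ‖c‖ ≤ 1 ∧ ¬ (‖a‖ < 1 ∧ ‖b‖ < 1 ∧ ‖c‖ < 1) ∧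
      a • x + b • y + c • z ∈ valueBall B hB han (‖p‖₊ ^ (i + 1)) := by
  have hpi : 0 < ‖p ^ i‖ := norm_pos_iff.2 (pow_ne_zero _ hp0)
  have key : ∀ t : k, ‖t‖ ≤ ((‖p‖₊ ^ i : NNReal) : ℝ) → ‖t / p ^ i‖ ≤ 1 := fun t ht => by
    rw [norm_div, div_le_one hpi, norm_pow]; exact_mod_cast ht
  rw [mem_valueBall] at hx hy hz
  obtain ⟨a, b, c, ha, hb, hc, h0, h⟩ := exists_ternary_small (key _ hx) (key _ hy) (key _ hz)
    (key _ (norm_form_add_le B hB han hx hy).1) (key _ (norm_form_add_le B hB han hx hz).1)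
    (key _ (norm_form_add_le B hB han hy hz).1)
  refine ⟨a, b, c, ha, hb, hc, h0, ?_⟩
  rw [mem_valueBall]
  have h1 : B (a • x + b • y + c • z) (a • x + b • y + c • z) = p ^ i *
      (B x x / p ^ i * a ^ 2 + B y y / p ^ i * b ^ 2 + B z z / p ^ i * c ^ 2 +
        2 * B x y / p ^ i * (a * b) + 2 * B x z / p ^ i * (a * c) +
        2 * B y z / p ^ i * (b * c)) := by
    have hpi' : p ^ i ≠ 0 := pow_ne_zero _ hp0
    simp only [map_add, map_smul, LinearMap.add_apply, LinearMap.smul_apply, smul_eq_mul, hB y x,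
      hB z x, hB z y]
    field_simp
    ring
  rw [h1, norm_mul, norm_pow]
  push_cast
  rw [pow_succ ‖p‖]
  exact mul_le_mul_of_nonneg_left (hp _ h) (by positivity)

theorem exists_generators_valueBall {p : k} (hp0 : p ≠ 0) (hp1 : ‖p‖ < 1)
    (hp : ∀ x : k, ‖x‖ < 1 → ‖x‖ ≤ ‖p‖) (i : ℕ) :
    ∃ x y : V, ∀ z ∈ valueBall B hB han (‖p‖₊ ^ i), ∃ a b : k,
      z - (a • x + b • y) ∈ valueBall B hB han (‖p‖₊ ^ (i + 1)) := by
  set L := valueBall B hB han (‖p‖₊ ^ i)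
  set M := valueBall B hB han (‖p‖₊ ^ (i + 1)) with hM
  have hsmall : ∀ z ∈ L, ∀ c : k, ‖c‖ < 1 → c • z ∈ M := by
    intro z hz c hc
    have := smul_mem_valueBall c hz
    rw [mem_valueBall] at this
    rw [hM, mem_valueBall]
    refine this.trans ?_
    have h1 := hp c hc
    push_cast
    calc ‖c‖ ^ 2 * ‖p‖ ^ i ≤ ‖p‖ ^ 2 * ‖p‖ ^ i := by gcongr
      _ ≤ ‖p‖ ^ 1 * ‖p‖ ^ i := by
        gcongr ?_ * _
        exact pow_le_pow_of_le_one (norm_nonneg _) hp1.le one_le_two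
      _ = _ := by ring
  have hunit : ∀ c : k, ‖c‖ ≤ 1 → ¬ ‖c‖ < 1 → c ≠ 0 ∧ ‖c⁻¹‖ ≤ 1 := by
    intro c h1 h2
    have : ‖c‖ = 1 := le_antisymm h1 (not_lt.1 h2)
    exact ⟨norm_pos_iff.1 (by rw [this]; exact one_pos), by rw [norm_inv, this, inv_one]⟩
  by_cases h2 : ∃ x ∈ L, ∃ y ∈ L, ∀ a b : k, ‖a‖ ≤ 1 → ‖b‖ ≤ 1 → a • x + b • y ∈ M →
      ‖a‖ < 1 ∧ ‖b‖ < 1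
  · obtain ⟨x, hx, y, hy, hxy⟩ := h2
    refine ⟨x, y, fun z hz => ?_⟩
    obtain ⟨a, b, c, ha, hb, hc, h0, h⟩ := exists_relation_valueBall hp0 hp i hx hy hz
    have hc1 : ¬ ‖c‖ < 1 := fun hc1 => by
      have h3 := M.sub_mem h (hsmall z hz c hc1)
      rw [add_sub_cancel_right] at h3
      obtain ⟨h4, h5⟩ := hxy a b ha hb h3
      exact h0 ⟨h4, h5, hc1⟩
    obtain ⟨hc0, hci⟩ := hunit c hc hc1
    refine ⟨-(c⁻¹ * a), -(c⁻¹ * b), ?_⟩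
    have := smul_mem_valueBall_of_le hci h
    rw [smul_add, smul_add, smul_smul, smul_smul, inv_smul_smul₀ hc0] at this
    rw [neg_smul, neg_smul, ← neg_add, sub_neg_eq_add, add_comm]
    exact this
  by_cases h1 : ∃ x ∈ L, x ∉ M
  · obtain ⟨x, hx, hxM⟩ := h1
    refine ⟨x, 0, fun z hz => ?_⟩
    push Not at h2
    obtain ⟨a, b, ha, hb, hab, hlt⟩ := h2 x hx z hz
    have hb1 : ¬ ‖b‖ < 1 := fun hb1 => by
      have h3 := M.sub_mem hab (hsmall z hz b hb1)
      rw [add_sub_cancel_right] at h3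
      by_cases ha1 : ‖a‖ < 1
      · exact absurd hb1 (not_lt.2 (hlt ha1))
      · obtain ⟨ha0, hai⟩ := hunit a ha ha1
        have := smul_mem_valueBall_of_le hai h3
        rw [inv_smul_smul₀ ha0] at this
        exact hxM this
    obtain ⟨hb0, hbi⟩ := hunit b hb hb1
    refine ⟨-(b⁻¹ * a), 0, ?_⟩
    have := smul_mem_valueBall_of_le hbi hab
    rw [smul_add, smul_smul, inv_smul_smul₀ hb0] at this
    rw [smul_zero, add_zero, neg_smul, sub_neg_eq_add, add_comm]
    exact this
  · push Not at h1
    exact ⟨0, 0, fun z hz => ⟨0, 0, by simpa using h1 z hz⟩⟩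
end

section
variable {k : Type} [NontriviallyNormedField k] [IsUltrametricDist k] [ProperSpace k]

theorem finrank_le_four_of_anisotropic {V : Type} [NormedAddCommGroup V] [NormedSpace k V]
    [FiniteDimensional k V] (B : LinearMap.BilinForm k V) (hB : ∀ x y, B x y = B y x)
    (han : ∀ x, B x x = 0 → x = 0) : Module.finrank k V ≤ 4 := by
  obtain ⟨p, hp0, hp1, hp⟩ := exists_uniformizer_norm k
  obtain ⟨x, y, hxy⟩ := exists_generators_valueBall (hB := hB) (han := han) hp0 hp1 hp 0
  obtain ⟨z, w, hzw⟩ := exists_generators_valueBall (hB := hB) (han := han) hp0 hp1 hp 1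
  have hspan : Submodule.span k (Set.range ![x, y, z, w]) = ⊤ := by
    by_contra hne
    set S := Submodule.span k (Set.range ![x, y, z, w])
    obtain ⟨l, hl0, hl⟩ := Submodule.exists_le_ker_of_lt_top S (lt_top_iff_ne_top.2 hne)
    have hlS : ∀ i, l (![x, y, z, w] i) = 0 := fun i => hl (Submodule.subset_span ⟨i, rfl⟩)
    have hlx : l x = 0 := hlS 0
    have hly : l y = 0 := hlS 1
    have hlz : l z = 0 := hlS 2
    have hlw : l w = 0 := hlS 3
    have hstep : ∀ v ∈ valueBall B hB han 1, ∃ v' ∈ valueBall B hB han 1, l v = p * l v' := by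
      intro v hv
      obtain ⟨a, b, h1⟩ := hxy v (by simpa using hv)
      obtain ⟨c, d, h2⟩ := hzw _ h1
      refine ⟨p⁻¹ • (v - (a • x + b • y) - (c • z + d • w)), ?_, ?_⟩
      · have := smul_mem_valueBall p⁻¹ h2
        rw [mem_valueBall] at this ⊢
        refine this.trans (le_of_eq ?_)
        have : ‖p‖ ≠ 0 := norm_ne_zero_iff.2 hp0
        simp only [nnnorm_inv]
        push_cast
        field_simp
      · rw [map_smul, smul_eq_mul, mul_inv_cancel_left₀ hp0]
        simp [hlx, hly, hlz, hlw]
    obtain ⟨δ, hδ, hbd⟩ := exists_pos_le_of_homogeneous (k := k) (E := V)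
      (isCompact_singleton (x := ())) (fun _ x => ‖B x x‖)
      ((continuous_bilinear B).comp (by fun_prop : Continuous fun p : Unit × V => (p.2, p.2))).norm
      (d := 2) two_ne_zero
      (fun _ t x => by
        rw [map_smul, map_smul, LinearMap.smul_apply, smul_eq_mul, smul_eq_mul, norm_mul, norm_mul]
        ring)
      (fun _ _ x hx => norm_pos_iff.2 fun h => hx (han x h))
    obtain ⟨C, hC⟩ : ∃ C : ℝ, ∀ v, ‖l v‖ ≤ C * ‖v‖ :=
      ⟨‖LinearMap.toContinuousLinearMap l‖, fun v => (LinearMap.toContinuousLinearMap l).le_opNorm v⟩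
    have hC' : ∀ v ∈ valueBall B hB han 1, ‖l v‖ ≤ |C| * (1 / δ + 1) := by
      intro v hv
      have h1 : δ * ‖v‖ ^ 2 ≤ 1 := (hbd () rfl v).trans hv
      have h2 : ‖v‖ ≤ 1 / δ + 1 := by
        have : ‖v‖ ^ 2 ≤ 1 / δ := by rwa [le_div_iff₀' hδ]
        nlinarith [sq_nonneg (‖v‖ - 1)]
      refine (hC v).trans ?_
      gcongr
      exact le_abs_self C
    have hpow : ∀ n : ℕ, ∀ v ∈ valueBall B hB han 1, ‖l v‖ ≤ ‖p‖ ^ n * (|C| * (1 / δ + 1)) := by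
      intro n
      induction n with
      | zero => simpa using hC'
      | succ n ih =>
        intro v hv
        obtain ⟨v', hv', h⟩ := hstep v hv
        rw [h, norm_mul, pow_succ']
        rw [mul_assoc]
        gcongr
        exact ih v' hv'
    have hzero : ∀ v ∈ valueBall B hB han 1, l v = 0 := by
      intro v hv
      have h1 : Filter.Tendsto (fun n : ℕ => ‖p‖ ^ n * (|C| * (1 / δ + 1))) Filter.atTop (nhds 0) := by
        simpa using (tendsto_pow_atTop_nhds_zero_of_lt_one (norm_nonneg p) hp1).mul_const
          (|C| * (1 / δ + 1))
      exact norm_le_zero_iff.1 (ge_of_tendsto' h1 fun n => hpow n v hv)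
    refine hl0 (LinearMap.ext fun v => ?_)
    obtain ⟨a, ha0, ha⟩ := NormedField.exists_norm_lt k (r := 1 / (‖B v v‖ + 1)) (by positivity)
    have ha' : a ≠ 0 := norm_pos_iff.1 ha0
    have h1 : a • v ∈ valueBall B hB han 1 := by
      rw [mem_valueBall]
      rw [lt_div_iff₀ (by positivity)] at ha
      simp only [map_smul, LinearMap.smul_apply, smul_eq_mul, norm_mul, NNReal.coe_one]
      have h3 : ‖a‖ * ‖B v v‖ ≤ 1 := by nlinarith
      have h4 : ‖a‖ ≤ 1 := by nlinarith [norm_nonneg (B v v)]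
      exact mul_le_one₀ h4 (by positivity) h3
    have h2 := hzero _ h1
    rw [map_smul, smul_eq_mul] at h2
    simpa using (mul_eq_zero.1 h2).resolve_left ha'
  have := finrank_range_le_card (R := k) ![x, y, z, w]
  rw [Set.finrank, hspan, finrank_top] at this
  simpa using this
end

end

section
open MeasureTheory Metric

section
variable {k : Type} [Field k]

/-- The bilinear form `B` has the diagonalization `a`, with nonzero entries. -/
def IsDiagBy {V ι : Type} [AddCommGroup V] [Module k V] [Fintype ι]
    (B : LinearMap.BilinForm k V) (a : ι → k) : Prop :=
  (∀ i, a i ≠ 0) ∧ ∃ L : (ι → k) ≃ₗ[k] V, ∀ x y, B (L x) (L y) = diagForm a x y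

theorem IsDiagBy.symm {V ι : Type} [AddCommGroup V] [Module k V] [Fintype ι]
    {B : LinearMap.BilinForm k V} {a : ι → k} (h : IsDiagBy B a) (x y : V) : B x y = B y x := by
  obtain ⟨-, L, hL⟩ := h
  obtain ⟨x, rfl⟩ := L.surjective x
  obtain ⟨y, rfl⟩ := L.surjective y
  rw [hL, hL, diagForm_symm]

theorem IsDiagBy.nondeg {V ι : Type} [AddCommGroup V] [Module k V] [Fintype ι]
    {B : LinearMap.BilinForm k V} {a : ι → k} (h : IsDiagBy B a) (x : V)
    (hx : ∀ y, B x y = 0) : x = 0 := by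
  obtain ⟨ha, L, hL⟩ := h
  obtain ⟨x, rfl⟩ := L.surjective x
  rw [diagForm_nondeg ha x fun y => by rw [← hL, hx], map_zero]

/-- The properties of the normalized Gauss integrals of the forms `a x ^ 2` over a local field,
viewed as functions of the coefficient `a`. -/
structure IsPhaseFunction (γ : k → ℂ) : Prop where
  norm : ∀ a, a ≠ 0 → ‖γ a‖ = 1
  neg : ∀ a, a ≠ 0 → γ (-a) = (starRingEnd ℂ) (γ a)
  equiv : ∀ {V ι : Type} [AddCommGroup V] [Module k V] [Fintype ι]
    (B : LinearMap.BilinForm k V) (a b : ι → k), IsDiagBy B a → IsDiagBy B b →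
    ∏ i, γ (a i) = ∏ i, γ (b i)
  constraint : ∀ {W V ι : Type} [AddCommGroup W] [Module k W] [AddCommGroup V] [Module k V]
    [FiniteDimensional k W] [FiniteDimensional k V] [Nontrivial W] [Fintype ι]
    (β : W →ₗ[k] LinearMap.BilinForm k V) (_ : ∀ w x y, β w x y = β w y x)
    (_ : ∀ x, x ≠ 0 → ∃ w, β w x x ≠ 0) (z : ℂ)
    (_ : ∀ w, w ≠ 0 → ∃ a : ι → k, IsDiagBy (β w) a ∧ ∏ i, γ (a i) = z),
    Fintype.card ι ≠ 2 * Module.finrank k W ∧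
      (2 * Module.finrank k W < Fintype.card ι → z = -1)
  four : ∀ {ι : Type} [Fintype ι] (a : ι → k), (∀ x, diagForm a x x = 0 → x = 0) →
    Fintype.card ι ≤ 4
end

section
variable {k : Type} [NontriviallyNormedField k] [ProperSpace k] [IsUltrametricDist k]

variable (k) in
theorem exists_isPhaseFunction_of_normed (h2 : (2 : k) ≠ 0) :
    ∃ γ : k → ℂ, IsPhaseFunction γ := by
  borelize k
  obtain ⟨e, he⟩ := exists_isStdChar k
  let μ₀ : Measure k := Measure.addHaar
  have hex : ∀ a : k, ∃ z, a ≠ 0 → HasPhase e μ₀ (fun x => a * (x * x)) z := by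
    intro a
    by_cases ha : a = 0
    · exact ⟨0, fun h => absurd ha h⟩
    · obtain ⟨z, hz⟩ := exists_hasPhase μ₀ h2 he (LinearMap.mul k k |>.compr₂ (LinearMap.lsmul k k a))
        (fun x y => by simp [mul_comm]) (fun x h => by simpa [ha] using h 1)
      exact ⟨z, fun _ => by simpa using hz⟩
  choose γ hγ using hex
  have hdiag : ∀ {ι : Type} [Fintype ι] (a : ι → k), (∀ i, a i ≠ 0) →
      HasPhase e (Measure.pi fun _ : ι => μ₀) (fun x => diagForm a x x) (∏ i, γ (a i)) :=
    fun a ha => hasPhase_diagForm μ₀ he a _ fun i => hγ _ (ha i)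
  refine ⟨γ, fun a ha => (hγ a ha).1, fun a ha => ?_, ?_, ?_, ?_⟩
  · have h1 := hγ (-a) (neg_ne_zero.2 ha)
    have h2 := (hγ a ha).neg he
    simp only [← neg_mul] at h2
    exact h1.unique h2
  · rintro V ι _ _ _ B a b ⟨ha, L, hL⟩ ⟨hb, M, hM⟩
    refine (HasPhase.unique (hasPhase_of_equiv _ h2 he (M.trans L.symm) (diagForm a) (diagForm b)
      (diagForm_symm b) (diagForm_nondeg hb) (fun x y => ?_) (hdiag b hb)) (hdiag a ha)).symm
    rw [← hL, ← hM]
    simp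
  · intro W V ι _ _ _ _ _ _ _ _ β hsymm haniso z hz
    obtain ⟨w₀, hw₀⟩ := exists_ne (0 : W)
    obtain ⟨a₀, ⟨-, L₀, -⟩, -⟩ := hz w₀ hw₀
    let P : (Fin (Module.finrank k W) → k) ≃ₗ[k] W := (Module.finBasis k W).equivFun.symm
    let β' : (Fin (Module.finrank k W) → k) →ₗ[k] LinearMap.BilinForm k (ι → k) :=
      { toFun := fun w => (β (P w)).compl₁₂ L₀.toLinearMap L₀.toLinearMap
        map_add' := fun w w' => by ext; simp
        map_smul' := fun c w => by ext; simp }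
    have hβ' : ∀ w x y, β' w x y = β (P w) (L₀ x) (L₀ y) := fun _ _ _ => rfl
    have : Nonempty (Fin (Module.finrank k W)) := ⟨⟨0, Module.finrank_pos⟩⟩
    have := phase_constraint μ₀ h2 he β' (fun w x y => by rw [hβ', hβ', hsymm]) ?_ ?_ (z := z) ?_
    · simpa using this
    · intro w hw x hx
      obtain ⟨a, ha, -⟩ := hz (P w) (by simpa using hw)
      have := ha.nondeg (L₀ x) fun y => by
        obtain ⟨y, rfl⟩ := L₀.surjective y
        rw [← hβ', hx]
      simpa using this
    · intro x hx
      obtain ⟨w, hw⟩ := haniso (L₀ x) (by simpa using hx)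
      obtain ⟨w, rfl⟩ := P.surjective w
      exact ⟨w, hw⟩
    · intro w hw
      obtain ⟨a, ha, rfl⟩ := hz (P w) (by simpa using hw)
      obtain ⟨ha0, L, hL⟩ := ha
      refine hasPhase_of_equiv _ h2 he (L.trans L₀.symm) (β' w) (diagForm a) (diagForm_symm a)
        (diagForm_nondeg ha0) (fun x y => ?_) (hdiag a ha0)
      rw [hβ', ← hL]
      simp
  · intro ι _ a ha
    have := finrank_le_four_of_anisotropic (diagForm a) (diagForm_symm a) ha
    simpa using this
end

section
variable {k : Type}

theorem exists_isPhaseFunction [Field k] [Valued k (WithZero (Multiplicative ℤ))] [CompleteSpace k]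
    (hdisc : Function.Surjective
      (Valued.v : Valuation k (WithZero (Multiplicative ℤ))))
    (hres : Finite (Valued.ResidueField k)) (h2 : (2 : k) ≠ 0) :
    ∃ γ : k → ℂ, IsPhaseFunction γ := by
  obtain ⟨nf, h, hu, hp⟩ := exists_properSpace_of_valued hdisc hres
  subst h
  exact exists_isPhaseFunction_of_normed k h2
end

end

section
variable {k : Type} [Field k] {V ι : Type} [AddCommGroup V] [Module k V] [Fintype ι]

theorem isDiagBy_of_linearMap [FiniteDimensional k V] {B : LinearMap.BilinForm k V} {a : ι → k}
    (ha : ∀ i, a i ≠ 0) (h : Module.finrank k V = Fintype.card ι) (L : (ι → k) →ₗ[k] V)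
    (hL : ∀ x y, B (L x) (L y) = diagForm a x y) : IsDiagBy B a := by
  have hinj : Function.Injective L := by
    rw [← LinearMap.ker_eq_bot, LinearMap.ker_eq_bot']
    exact fun x hx => diagForm_nondeg ha x fun y => by rw [← hL, hx, map_zero]; rfl
  refine ⟨ha, LinearEquiv.ofInjectiveOfFinrankEq L hinj (by simp [h]), fun x y => ?_⟩
  exact hL x y

theorem isDiagBy_diagForm_of_mul_sq {a b t : ι → k} (ha : ∀ i, a i ≠ 0)
    (h : ∀ i, a i = b i * t i ^ 2) : IsDiagBy (diagForm b) a := by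
  refine isDiagBy_of_linearMap ha (by simp)
    (LinearMap.pi fun i => t i • LinearMap.proj i) fun x y => ?_
  simp only [diagForm_apply, LinearMap.pi_apply, LinearMap.smul_apply, LinearMap.proj_apply,
    smul_eq_mul, h]
  exact Finset.sum_congr rfl fun i _ => by ring

theorem IsDiagBy.trans {κ : Type} [Fintype κ] {B : LinearMap.BilinForm k V} {a : ι → k}
    {b : κ → k} (h : IsDiagBy B a) (h' : IsDiagBy (diagForm a) b) : IsDiagBy B b := by
  obtain ⟨-, L, hL⟩ := h
  obtain ⟨hb, M, hM⟩ := h'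
  exact ⟨hb, M.trans L, fun x y => by simp [hL, hM]⟩

theorem isDiagBy_self {a : ι → k} (ha : ∀ i, a i ≠ 0) : IsDiagBy (diagForm a) a :=
  ⟨ha, LinearEquiv.refl _ _, fun _ _ => rfl⟩

theorem IsDiagBy.prod_eq_of_twist [DecidableEq ι] {B B' : LinearMap.BilinForm k V} {a b : ι → k}
    (ha : IsDiagBy B a) (hb : IsDiagBy B' b) (N : V →ₗ[k] V) (hN : ∀ x y, B' x y = B (N x) y) :
    ∃ s : k, s ≠ 0 ∧ ∏ i, b i = s ^ 2 * LinearMap.det N * ∏ i, a i := by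
  obtain ⟨ha0, L, hL⟩ := ha
  obtain ⟨hb0, M, hM⟩ := hb
  let N' := L.symm.toLinearMap ∘ₗ N ∘ₗ L.toLinearMap
  let P := LinearMap.toMatrix' (M.trans L.symm).toLinearMap
  let Q := LinearMap.toMatrix' N'
  have hP : ∀ x, P.mulVec x = L.symm (M x) := fun x => by
    simp [P, LinearMap.toMatrix'_mulVec]
  have hQ : ∀ x, (Q * P).mulVec x = L.symm (N (M x)) := fun x => by
    rw [← Matrix.mulVec_mulVec, hP]
    simp [Q, N', LinearMap.toMatrix'_mulVec]
  have h : ∀ x y, diagForm a ((Q * P).mulVec x) (P.mulVec y) = diagForm b x y := fun x y => by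
    rw [← hL, ← hM, hN]; simp [hP, hQ]
  have hmat : (Q * P).transpose * Matrix.diagonal a * P = Matrix.diagonal b := by
    ext i j
    have := h (Pi.single i 1) (Pi.single j 1)
    simp only [Matrix.mulVec_single_one, diagForm_apply, Matrix.col_apply] at this
    rw [Matrix.mul_apply]
    simp only [Matrix.mul_diagonal, Matrix.transpose_apply]
    convert this using 1
    · exact Finset.sum_congr rfl fun _ _ => by ring
    · rw [Matrix.diagonal_apply]
      by_cases hij : i = j
      · subst hij; simp [Pi.single_apply]
      · simp [Pi.single_apply, hij, Ne.symm hij]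
  have hdet := congrArg Matrix.det hmat
  have hQd : Q.det = LinearMap.det N := by
    rw [← LinearMap.det_conj N L.symm]
    exact LinearMap.det_toMatrix' N'
  rw [Matrix.det_mul, Matrix.det_mul, Matrix.det_transpose, Matrix.det_diagonal,
    Matrix.det_diagonal, Matrix.det_mul, hQd] at hdet
  refine ⟨P.det, fun h0 => ?_, by rw [← hdet]; ring⟩
  rw [h0, mul_zero] at hdet
  exact Finset.prod_ne_zero_iff.2 (fun i _ => hb0 i) hdet.symm

theorem IsDiagBy.isSquare_mul_prod [DecidableEq ι] {B : LinearMap.BilinForm k V} {a b : ι → k}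
    (ha : IsDiagBy B a) (hb : IsDiagBy B b) : ∃ s : k, s ≠ 0 ∧ ∏ i, b i = s ^ 2 * ∏ i, a i := by
  obtain ⟨s, hs, h⟩ := ha.prod_eq_of_twist hb LinearMap.id fun _ _ => rfl
  exact ⟨s, hs, by simpa using h⟩

theorem exists_isDiagBy [FiniteDimensional k V] (h2 : (2 : k) ≠ 0)
    (B : LinearMap.BilinForm k V) (hB : ∀ x y, B x y = B y x)
    (hnd : ∀ x, (∀ y, B x y = 0) → x = 0) {n : ℕ} (hn : Module.finrank k V = n) :
    ∃ a : Fin n → k, IsDiagBy B a := by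
  subst hn
  have := invertibleOfNonzero h2
  obtain ⟨v, hv⟩ := LinearMap.BilinForm.exists_orthogonal_basis (B := B) ⟨hB⟩
  have hB0 : ∀ i x, B (v i) x = B (v i) (v i) * v.repr x i := fun i x => by
    conv_lhs => rw [← v.sum_repr x]
    rw [map_sum, Finset.sum_eq_single i]
    · rw [map_smul, smul_eq_mul, mul_comm]
    · intro j _ hj
      rw [map_smul, smul_eq_mul, (hv hj.symm : B (v i) (v j) = 0), mul_zero]
    · simp
  refine ⟨fun i => B (v i) (v i), fun i h => v.ne_zero i (hnd _ fun y => by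
      simp only at h
      rw [hB0, h, zero_mul]),
    v.equivFun.symm, fun x y => ?_⟩
  rw [diagForm_apply, v.equivFun_symm_apply, map_sum, LinearMap.sum_apply]
  refine Finset.sum_congr rfl fun i _ => ?_
  rw [map_smul, LinearMap.smul_apply, hB0, ← v.equivFun_apply, v.equivFun.apply_symm_apply,
    smul_eq_mul]
  ring

theorem exists_isDiagBy_cons [FiniteDimensional k V] (h2 : (2 : k) ≠ 0)
    (B : LinearMap.BilinForm k V) (hB : ∀ x y, B x y = B y x)
    (hnd : ∀ x, (∀ y, B x y = 0) → x = 0) {n : ℕ} (hn : Module.finrank k V = n + 1)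
    {v : V} {c : k} (hv : B v v = c) (hc : c ≠ 0) :
    ∃ a : Fin n → k, IsDiagBy B (Fin.cons c a : Fin (n + 1) → k) := by
  let U : Submodule k V := LinearMap.ker (B v)
  have hU : Module.finrank k U = n := by
    have h1 : Function.Surjective (B v) := fun t => ⟨(t / c) • v, by simp [hv, hc]⟩
    have h2 := LinearMap.finrank_range_add_finrank_ker (B v)
    rw [LinearMap.range_eq_top.2 h1, finrank_top, Module.finrank_self, hn] at h2
    change Module.finrank k (LinearMap.ker (B v)) = n
    omega
  have hdec : ∀ x : V, x - (B v x / c) • v ∈ U := fun x => by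
    simp [U, hv, hc]
  obtain ⟨a, ha0, L, hL⟩ := exists_isDiagBy (V := U) h2 (B.restrict U) (fun x y => hB x y) (by
    rintro ⟨x, hx⟩ h
    have hx' : B v x = 0 := hx
    refine Subtype.ext (hnd x fun y => ?_)
    have := h ⟨_, hdec y⟩
    simpa [hB x v, hx'] using this) hU
  have hL' : ∀ x y, B (L x) (L y) = diagForm a x y := hL
  refine ⟨a, isDiagBy_of_linearMap (Fin.cases hc ha0) (by simp [hn])
    ((LinearMap.toSpanSingleton k V v).comp (LinearMap.proj 0) +
      (U.subtype.comp L.toLinearMap).comp (LinearMap.funLeft k k Fin.succ)) fun x y => ?_⟩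
  have h0 : ∀ z, B v (L z) = 0 := fun z => (L z).2
  have h0' : ∀ z, B (L z) v = 0 := fun z => by rw [hB, h0]
  simp [hv, h0, h0', hL', Fin.sum_univ_succ, LinearMap.funLeft_apply]
  ring
end

section
variable {k : Type} [Field k] {ι : Type} [Fintype ι]

theorem diagForm_sum_elim {κ : Type} [Fintype κ] (a : ι → k) (b : κ → k) (x y : ι ⊕ κ → k) :
    diagForm (Sum.elim a b) x y =
      diagForm a (x ∘ Sum.inl) (y ∘ Sum.inl) + diagForm b (x ∘ Sum.inr) (y ∘ Sum.inr) := by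
  simp

theorem exists_eq_of_isotropic (h2 : (2 : k) ≠ 0) {a : ι → k} (ha : ∀ i, a i ≠ 0) {x : ι → k}
    (hx : x ≠ 0) (h : diagForm a x x = 0) (c : k) : ∃ y, diagForm a y y = c := by
  obtain ⟨y, hy⟩ : ∃ y, diagForm a x y ≠ 0 := by
    by_contra! h'
    exact hx (diagForm_nondeg ha x h')
  refine ⟨((c - diagForm a y y) / (2 * diagForm a x y)) • x + y, ?_⟩
  have h1 := diagForm_symm a y x
  generalize diagForm a = B at *
  simp only [map_add, map_smul, LinearMap.add_apply, LinearMap.smul_apply, smul_eq_mul, h, h1]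
  field_simp
  ring

theorem exists_common_value (h2 : (2 : k) ≠ 0) {n : ℕ} {a b : Fin (n + 1) → k}
    (ha : ∀ i, a i ≠ 0) (hb : ∀ i, b i ≠ 0) {x : Fin (n + 1) ⊕ Fin (n + 1) → k} (hx : x ≠ 0)
    (h : diagForm (Sum.elim a (fun i => -b i)) x x = 0) :
    ∃ c ≠ 0, (∃ y, diagForm a y y = c) ∧ ∃ y, diagForm b y y = c := by
  have hneg : ∀ y, diagForm (fun i => -b i) y y = -diagForm b y y := fun y => by simp
  have hval : ∀ a : Fin (n + 1) → k, diagForm a (Pi.single 0 1) (Pi.single 0 1) = a 0 := fun a => by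
    simp [Pi.single_apply]
  rw [diagForm_sum_elim, hneg, ← sub_eq_add_neg, sub_eq_zero] at h
  by_cases h0 : diagForm a (x ∘ Sum.inl) (x ∘ Sum.inl) = 0
  · by_cases hl : x ∘ Sum.inl = 0
    · have hr : x ∘ Sum.inr ≠ 0 := fun hr => hx <| by
        ext i
        rcases i with i | i
        · exact congrFun hl i
        · exact congrFun hr i
      exact ⟨a 0, ha 0, ⟨_, hval a⟩, exists_eq_of_isotropic h2 hb hr (h ▸ h0) _⟩
    · exact ⟨b 0, hb 0, exists_eq_of_isotropic h2 ha hl h0 _, ⟨_, hval b⟩⟩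
  · exact ⟨_, h0, ⟨_, rfl⟩, ⟨_, h.symm⟩⟩

namespace IsPhaseFunction
variable {γ : k → ℂ}

theorem quaternion (hγ : IsPhaseFunction γ) {a A C : k}
    (ha : a ≠ 0) (hA : A ≠ 0) (hC : C ≠ 0)
    (han : ∀ x, diagForm ![a, -(a * A), -(a * C), a * A * C] x x = 0 → x = 0) :
    γ a * γ (-(a * A)) * γ (-(a * C)) * γ (a * A * C) = -1 := by
  set P : Fin 4 → k := ![a, -(a * A), -(a * C), a * A * C] with hP
  have hP0 : ∀ i, P i ≠ 0 := by
    intro i; fin_cases i <;> simp [P, ha, hA, hC]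
  have hform : ∀ x y, diagForm P x y = a * (x 0 * y 0 - A * (x 1 * y 1) - C * (x 2 * y 2) +
      A * C * (x 3 * y 3)) := fun x y => by
    simp [P, Fin.sum_univ_succ]; ring
  have huniv : ∀ u ≠ 0, ∃ q : Fin 4 → k,
      q 0 ^ 2 - A * q 1 ^ 2 - C * q 2 ^ 2 + A * C * q 3 ^ 2 = u := by
    intro u hu
    by_contra! hne
    have h5 := hγ.four (ι := Fin 4 ⊕ Unit) (Sum.elim P (fun _ => -(a * u))) (fun x hx => by
      rw [diagForm_sum_elim, hform] at hx
      simp only [diagForm_apply, Finset.univ_unique, Finset.sum_singleton, Function.comp] at hx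
      set t := x (Sum.inr default) with ht
      have ht0 : t = 0 := by
        by_contra ht0
        refine hne (fun i => x (Sum.inl i) / t) ?_
        field_simp
        refine mul_left_cancel₀ ha ?_
        linear_combination hx
      have hl : x ∘ Sum.inl = 0 := by
        apply han
        rw [hform]
        rw [ht0] at hx
        simpa using hx
      ext i
      rcases i with i | i
      · exact congrFun hl i
      · exact ht0)
    simp at h5
  have key := (hγ.constraint (W := k) (V := Fin 4 → k) (ι := Fin 4)
    (LinearMap.toSpanSingleton k _ (diagForm P))
    (fun w x y => by
      simp only [LinearMap.toSpanSingleton_apply, LinearMap.smul_apply, diagForm_symm P x y])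
    (fun x hx => ⟨1, by
      rw [LinearMap.toSpanSingleton_apply, one_smul]
      exact fun h => hx (han x h)⟩) (∏ i, γ (P i)) ?_).2 (by simp)
  · rw [← key]
    simp [P, Fin.prod_univ_succ, mul_assoc]
  · intro u hu
    obtain ⟨q, hq⟩ := huniv u⁻¹ (inv_ne_zero hu)
    refine ⟨P, isDiagBy_of_linearMap hP0 (by simp) ((Matrix.of ![
      ![q 0, A * q 1, C * q 2, -(A * C * q 3)],
      ![q 1, q 0, C * q 3, -(C * q 2)],
      ![q 2, -(A * q 3), q 0, A * q 1],
      ![q 3, -q 2, q 1, q 0]]).mulVecLin) fun x y => ?_, rfl⟩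
    rw [LinearMap.toSpanSingleton_apply, LinearMap.smul_apply, LinearMap.smul_apply, hform, hform,
      smul_eq_mul]
    simp [Matrix.mulVec, dotProduct, Fin.sum_univ_succ]
    have hq' := congrArg (u * ·) hq
    simp only [mul_inv_cancel₀ hu] at hq'
    linear_combination a * (x 0 * y 0 - A * (x 1 * y 1) - C * (x 2 * y 2) +
      A * C * (x 3 * y 3)) * hq'

theorem binary (hγ : IsPhaseFunction γ) {a b c d s : k}
    (ha : a ≠ 0) (hb : b ≠ 0) (hc : c ≠ 0) (hd : d ≠ 0) (hs : a * b * (c * d) = s ^ 2)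
    (han : ∀ x, diagForm ![a, b, -c, -d] x x = 0 → x = 0) :
    γ a * γ b = -(γ c * γ d) := by
  have hs0 : s ≠ 0 := by
    rintro rfl
    simp [ha, hb, hc, hd] at hs
  let P : Fin 4 → k := ![a, -(a * (-(a * b))), -(a * (a * c)), a * (-(a * b)) * (a * c)]
  have hiso : IsDiagBy (diagForm ![a, b, -c, -d]) P := by
    refine isDiagBy_diagForm_of_mul_sq (t := ![1, a, a, a ^ 2 * b * c / s]) (fun i => ?_) fun i => ?_
    · fin_cases i <;> simp [P, ha, hb, hc]
    · fin_cases i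
      · simp [P]
      · simp [P]; ring
      · simp [P]; ring
      · simp [P]; field_simp; linear_combination -hs
  have h1 := hγ.equiv _ _ _ (isDiagBy_self (a := ![a, b, -c, -d]) (fun i => by
    fin_cases i <;> simp [ha, hb, hc, hd])) hiso
  have h2 := hγ.quaternion (a := a) (A := -(a * b)) (C := a * c) ha
    (neg_ne_zero.2 (mul_ne_zero ha hb)) (mul_ne_zero ha hc) (fun x hx => by
      obtain ⟨-, L, hL⟩ := hiso
      have := han (L x) (by rw [hL]; exact hx)
      simpa using this)
  have h3 : ∏ i, γ (P i) = -1 := by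
    rw [← h2]
    simp [P, Fin.prod_univ_succ, mul_assoc]
  rw [h3] at h1
  simp only [Fin.prod_univ_succ, Fin.prod_univ_zero, Matrix.cons_val_zero, Matrix.cons_val_succ,
    mul_one] at h1
  rw [hγ.neg c hc, hγ.neg d hd] at h1
  have hcc : γ c * (starRingEnd ℂ) (γ c) = 1 := by
    rw [Complex.mul_conj, Complex.normSq_eq_norm_sq, hγ.norm c hc]; simp
  have hdd : γ d * (starRingEnd ℂ) (γ d) = 1 := by
    rw [Complex.mul_conj, Complex.normSq_eq_norm_sq, hγ.norm d hd]; simp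
  linear_combination (γ c * γ d) * h1 - γ a * γ b * γ d * (starRingEnd ℂ) (γ d) * hcc -
    γ a * γ b * hdd

theorem isDiagBy_or_eq_neg (hγ : IsPhaseFunction γ) (h2 : (2 : k) ≠ 0) :
    ∀ {n : ℕ} {a b : Fin n → k} {s : k}, (∀ i, a i ≠ 0) → (∀ i, b i ≠ 0) →
      (∏ i, a i) * ∏ i, b i = s ^ 2 →
      IsDiagBy (diagForm a) b ∨ ∏ i, γ (a i) = -∏ i, γ (b i) := by
  intro n
  induction n with
  | zero =>
    intro a b s ha hb hs
    left
    rw [Subsingleton.elim b a]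
    exact isDiagBy_self ha
  | succ n ih =>
    intro a b s ha hb hs
    by_cases han : ∀ x, diagForm (Sum.elim a (fun i => -b i)) x x = 0 → x = 0
    · have h4 := hγ.four _ han
      simp only [Fintype.card_sum, Fintype.card_fin] at h4
      obtain rfl | rfl : n = 0 ∨ n = 1 := by omega
      · left
        simp only [Fin.prod_univ_succ, Fin.prod_univ_zero, mul_one] at hs
        refine isDiagBy_diagForm_of_mul_sq (t := fun _ => s / a 0) hb fun i => ?_
        rw [show i = 0 from Subsingleton.elim (α := Fin 1) i 0]
        have := ha 0
        field_simp
        linear_combination hs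
      · right
        have h01 : ∀ f : Fin 2 → ℂ, ∏ i, f i = f 0 * f 1 := fun f => by simp [Fin.prod_univ_succ]
        have h01' : ∀ f : Fin 2 → k, ∏ i, f i = f 0 * f 1 := fun f => by simp [Fin.prod_univ_succ]
        rw [h01, h01]
        rw [h01', h01'] at hs
        refine hγ.binary (ha 0) (ha 1) (hb 0) (hb 1) hs fun x hx => ?_
        have := han (Sum.elim ![x 0, x 1] ![x 2, x 3]) (by
          rw [← hx]
          simp [Fin.sum_univ_succ]
          ring)
        ext i
        fin_cases i
        · exact congrFun this (Sum.inl 0)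
        · exact congrFun this (Sum.inl 1)
        · exact congrFun this (Sum.inr 0)
        · exact congrFun this (Sum.inr 1)
    · push Not at han
      obtain ⟨x, hx, hx0⟩ := han
      obtain ⟨c, hc, ⟨y, hy⟩, z, hz⟩ := exists_common_value h2 ha hb hx0 hx
      obtain ⟨a', ha'⟩ := exists_isDiagBy_cons (n := n) h2 _ (diagForm_symm a) (diagForm_nondeg ha)
        (by simp) hy hc
      obtain ⟨b', hb'⟩ := exists_isDiagBy_cons (n := n) h2 _ (diagForm_symm b) (diagForm_nondeg hb)
        (by simp) hz hc
      obtain ⟨u, hu, hu'⟩ := (isDiagBy_self ha).isSquare_mul_prod ha'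
      obtain ⟨v, hv, hv'⟩ := (isDiagBy_self hb).isSquare_mul_prod hb'
      have pa := hγ.equiv _ _ _ (isDiagBy_self ha) ha'
      have pb := hγ.equiv _ _ _ (isDiagBy_self hb) hb'
      rw [Fin.prod_univ_succ] at hu' hv'
      rw [pa, pb, Fin.prod_univ_succ, Fin.prod_univ_succ (n := n)]
      simp only [Fin.cons_zero, Fin.cons_succ] at hu' hv' ⊢
      rcases ih (s := u * v * s / c) (fun i => by simpa using ha'.1 i.succ)
        (fun i => by simpa using hb'.1 i.succ) (by
          field_simp
          linear_combination (c * ∏ i, b' i) * hu' + (u ^ 2 * ∏ i, a i) * hv' +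
            u ^ 2 * v ^ 2 * hs) with h | h
      · left
        have hcons : IsDiagBy (diagForm (Fin.cons c a' : Fin (n + 1) → k))
            (Fin.cons c b' : Fin (n + 1) → k) := by
          obtain ⟨hb0, L, hL⟩ := h
          refine isDiagBy_of_linearMap hb'.1 (by simp)
            { toFun := fun x => Fin.cons (x 0) (L (fun i => x i.succ))
              map_add' := fun x y => ?_
              map_smul' := fun r x => ?_ } fun x y => ?_
          · funext i
            refine Fin.cases ?_ (fun i => ?_) i
            · simp
            · exact congrFun (L.map_add (fun i => x i.succ) (fun i => y i.succ)) i
          · funext i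
            refine Fin.cases ?_ (fun i => ?_) i
            · simp
            · exact congrFun (L.map_smul r (fun i => x i.succ)) i
          · have := hL (fun i => x i.succ) (fun i => y i.succ)
            simp only [diagForm_apply] at this
            simp only [diagForm_apply, LinearMap.coe_mk, AddHom.coe_mk, Fin.sum_univ_succ,
              Fin.cons_zero, Fin.cons_succ, this]
        obtain ⟨-, L, hL⟩ := (ha'.trans hcons)
        obtain ⟨-, M, hM⟩ := hb'
        exact ⟨hb, M.symm.trans L, fun x y => by
          rw [LinearEquiv.trans_apply, LinearEquiv.trans_apply, hL, ← hM]; simp⟩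
      · right
        rw [h]
        ring
end IsPhaseFunction
end

section
variable {k : Type} [Field k]

/-- The orthogonal direct sum of two bilinear forms. -/
def prodForm {M N : Type} [AddCommGroup M] [AddCommGroup N] [Module k M] [Module k N]
    (B : LinearMap.BilinForm k M) (C : LinearMap.BilinForm k N) : LinearMap.BilinForm k (M × N) :=
  B.compl₁₂ (LinearMap.fst k M N) (LinearMap.fst k M N) +
    C.compl₁₂ (LinearMap.snd k M N) (LinearMap.snd k M N)

@[simp]
theorem prodForm_apply {M N : Type} [AddCommGroup M] [AddCommGroup N] [Module k M] [Module k N]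
    (B : LinearMap.BilinForm k M) (C : LinearMap.BilinForm k N) (x y : M × N) :
    prodForm B C x y = B x.1 y.1 + C x.2 y.2 := rfl

theorem IsDiagBy.prodForm {M N ι κ : Type} [AddCommGroup M] [AddCommGroup N] [Module k M]
    [Module k N] [Fintype ι] [Fintype κ] {B : LinearMap.BilinForm k M}
    {C : LinearMap.BilinForm k N} {a : ι → k} {b : κ → k} (h : IsDiagBy B a)
    (h' : IsDiagBy C b) : IsDiagBy (prodForm B C) (Sum.elim a b) := by
  obtain ⟨ha, L, hL⟩ := h
  obtain ⟨hb, L', hL'⟩ := h'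
  refine ⟨fun i => by rcases i with i | i <;> simp [ha, hb],
    (LinearEquiv.sumArrowLequivProdArrow ι κ k k).trans (L.prodCongr L'), fun x y => ?_⟩
  rw [diagForm_sum_elim, ← hL, ← hL']
  rfl

theorem IsDiagBy.reindex {V ι κ : Type} [AddCommGroup V] [Module k V] [Fintype ι] [Fintype κ]
    {B : LinearMap.BilinForm k V} {a : ι → k} (h : IsDiagBy B a) (e : κ ≃ ι) :
    IsDiagBy B (a ∘ e) := by
  obtain ⟨ha, L, hL⟩ := h
  refine ⟨fun i => ha _, (LinearEquiv.funCongrLeft k k e.symm).trans L, fun x y => ?_⟩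
  rw [LinearEquiv.trans_apply, LinearEquiv.trans_apply, hL, diagForm_apply, diagForm_apply,
    ← e.sum_comp]
  simp [LinearEquiv.funCongrLeft_apply, LinearMap.funLeft_apply]

theorem IsDiagBy.smul {V ι : Type} [AddCommGroup V] [Module k V] [Fintype ι]
    {B : LinearMap.BilinForm k V} {a : ι → k} (h : IsDiagBy B a) {c : k} (hc : c ≠ 0) :
    IsDiagBy (c • B) (c • a) := by
  obtain ⟨ha, L, hL⟩ := h
  refine ⟨fun i => by simp [hc, ha], L, fun x y => ?_⟩
  simp [hL, Finset.mul_sum, mul_assoc]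

theorem IsPhaseFunction.isDiagBy_or_eq_neg' {γ : k → ℂ} (hγ : IsPhaseFunction γ)
    (h2 : (2 : k) ≠ 0) {ι : Type} [Fintype ι] {a b : ι → k} {s : k} (ha : ∀ i, a i ≠ 0)
    (hb : ∀ i, b i ≠ 0) (hs : (∏ i, a i) * ∏ i, b i = s ^ 2) :
    IsDiagBy (diagForm a) b ∨ ∏ i, γ (a i) = -∏ i, γ (b i) := by
  let e := Fintype.equivFin ι
  rcases hγ.isDiagBy_or_eq_neg h2 (a := a ∘ e.symm) (b := b ∘ e.symm) (s := s)
    (fun i => ha _) (fun i => hb _) (by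
      rw [← hs, ← e.symm.prod_comp, ← e.symm.prod_comp b]; rfl) with h | h
  · left
    have h1 := ((isDiagBy_self ha).reindex e.symm).trans h
    have h2 := h1.reindex e
    simpa [Function.comp_def] using h2
  · right
    rw [← e.symm.prod_comp, ← e.symm.prod_comp fun i => γ (b i)]
    exact h

theorem IsPhaseFunction.ne_zero {γ : k → ℂ} (hγ : IsPhaseFunction γ) {ι : Type} [Fintype ι]
    {a : ι → k} (ha : ∀ i, a i ≠ 0) : ∏ i, γ (a i) ≠ 0 :=
  Finset.prod_ne_zero_iff.2 fun i _ => norm_ne_zero_iff.1 (by rw [hγ.norm _ (ha i)]; exact one_ne_zero)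

/-- Given a linear family `β` of anisotropic-in-family forms in twice as many variables as
parameters, with constant discriminant, every form of the right dimension is an orthogonal sum of
a member of the family, a one-dimensional form, and a given form. -/
theorem IsPhaseFunction.exists_equiv_prodForm {γ : k → ℂ} (hγ : IsPhaseFunction γ)
    (h2 : (2 : k) ≠ 0) {W L K₀ U V : Type} [AddCommGroup W] [Module k W] [AddCommGroup L]
    [Module k L] [AddCommGroup K₀] [Module k K₀] [AddCommGroup U] [Module k U] [AddCommGroup V]
    [Module k V] [FiniteDimensional k W] [FiniteDimensional k L] [FiniteDimensional k K₀]
    [FiniteDimensional k U] [FiniteDimensional k V]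
    (β : W →ₗ[k] LinearMap.BilinForm k L) (hβ : ∀ w x y, β w x y = β w y x)
    (hβnd : ∀ w, w ≠ 0 → ∀ x, (∀ y, β w x y = 0) → x = 0)
    (hβan : ∀ x, x ≠ 0 → ∃ w, β w x x ≠ 0)
    (w₁ : W) (hw₁ : w₁ ≠ 0) (N : W → L →ₗ[k] L) (hN : ∀ w x y, β w x y = β w₁ (N w x) y)
    (r : W → k) (hr : ∀ w, LinearMap.det (N w) = r w ^ 2)
    (hdim : Module.finrank k L = 2 * Module.finrank k W)
    (B₀ : LinearMap.BilinForm k K₀) (hB₀ : ∀ x y, B₀ x y = B₀ y x)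
    (hB₀nd : ∀ x, (∀ y, B₀ x y = 0) → x = 0) (hK₀ : Module.finrank k K₀ = 1)
    (G : LinearMap.BilinForm k U) (hG : ∀ x y, G x y = G y x)
    (hGnd : ∀ x, (∀ y, G x y = 0) → x = 0)
    (B : LinearMap.BilinForm k V) (hB : ∀ x y, B x y = B y x)
    (hBnd : ∀ x, (∀ y, B x y = 0) → x = 0)
    (hV : Module.finrank k V = Module.finrank k L + (Module.finrank k K₀ + Module.finrank k U)) :
    ∃ w ≠ 0, ∃ d : k, d ≠ 0 ∧ ∃ Φ : V ≃ₗ[k] L × (K₀ × U),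
      ∀ x y, prodForm (β w) (prodForm (d • B₀) G) (Φ x) (Φ y) = B x y := by
  have : Nontrivial W := ⟨w₁, 0, hw₁⟩
  have hexa : ∀ w, ∃ a : Fin (Module.finrank k L) → k, w ≠ 0 → IsDiagBy (β w) a := fun w => by
    by_cases hw : w = 0
    · exact ⟨0, fun h => absurd hw h⟩
    · obtain ⟨a, ha⟩ := exists_isDiagBy h2 (β w) (hβ w) (hβnd w hw) rfl
      exact ⟨a, fun _ => ha⟩
  choose a ha using hexa
  obtain ⟨c, hc⟩ := exists_isDiagBy h2 B₀ hB₀ hB₀nd hK₀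
  obtain ⟨g, hg⟩ := exists_isDiagBy h2 G hG hGnd rfl
  obtain ⟨b', hb'⟩ := exists_isDiagBy h2 B hB hBnd rfl
  let ι := Fin (Module.finrank k L) ⊕ (Fin 1 ⊕ Fin (Module.finrank k U))
  let e : ι ≃ Fin (Module.finrank k V) := Fintype.equivOfCardEq (by simp [ι, hV, hK₀])
  obtain ⟨b, hb⟩ : ∃ b : ι → k, IsDiagBy B b := ⟨_, hb'.reindex e⟩
  have hprod : ∀ {w}, w ≠ 0 → ∏ i, a w i ≠ 0 := fun hw => Finset.prod_ne_zero_iff.2 fun i _ => (ha _ hw).1 i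
  have hprodg : ∏ i, g i ≠ 0 := Finset.prod_ne_zero_iff.2 fun i _ => hg.1 i
  have hprodb : ∏ i, b i ≠ 0 := Finset.prod_ne_zero_iff.2 fun i _ => hb.1 i
  obtain ⟨d, hd⟩ : ∃ d, d = (∏ i, a w₁ i) * c 0 * (∏ i, g i) * ∏ i, b i := ⟨_, rfl⟩
  have hd0 : d ≠ 0 := by
    rw [hd]
    exact mul_ne_zero (mul_ne_zero (mul_ne_zero (hprod hw₁) (hc.1 0)) hprodg) hprodb
  have hdiag : ∀ w, w ≠ 0 → IsDiagBy (prodForm (β w) (prodForm (d • B₀) G))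
      (Sum.elim (a w) (Sum.elim (d • c) g)) := fun w hw =>
    (ha w hw).prodForm ((hc.smul hd0).prodForm hg)
  by_contra! hcon
  have hphase : ∀ w, w ≠ 0 → ∏ i, γ (a w i) =
      (-∏ i, γ (b i)) / (γ (d * c 0) * ∏ i, γ (g i)) := by
    intro w hw
    obtain ⟨s, hs, h⟩ := (ha w₁ hw₁).prod_eq_of_twist (ha w hw) (N w) (hN w)
    rw [hr w] at h
    rcases hγ.isDiagBy_or_eq_neg' h2 (hdiag w hw).1 hb.1 (s := s * r w * d) (by
      simp only [Fintype.prod_sum_type, Sum.elim_inl, Sum.elim_inr, h, Fin.prod_univ_one, Pi.smul_apply,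
        smul_eq_mul]
      rw [Fintype.prod_sum_type, Fintype.prod_sum_type, Fin.prod_univ_one] at hd
      linear_combination (-(s * r w) ^ 2 * d) * hd) with h1 | h1
    · obtain ⟨-, Φ, hΦ⟩ := (hdiag w hw).trans h1
      obtain ⟨-, Ψ, hΨ⟩ := hb
      obtain ⟨x, y, hxy⟩ := hcon w hw d hd0 (Ψ.symm.trans Φ)
      refine absurd ?_ hxy
      rw [LinearEquiv.trans_apply, LinearEquiv.trans_apply, hΦ, ← hΨ]
      simp
    · rw [Fintype.prod_sum_type, Fintype.prod_sum_type, Fin.prod_univ_one] at h1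
      simp only [Sum.elim_inl, Sum.elim_inr, Pi.smul_apply, smul_eq_mul] at h1
      have h3 : γ (d * c 0) ≠ 0 := norm_ne_zero_iff.1 (by
        rw [hγ.norm _ (mul_ne_zero hd0 (hc.1 0))]; exact one_ne_zero)
      rw [eq_div_iff (mul_ne_zero h3 (hγ.ne_zero hg.1))]
      exact h1
  have := (hγ.constraint (ι := Fin (Module.finrank k L)) β hβ hβan _
    fun w hw => ⟨a w, ha w hw, hphase w hw⟩).1
  simp only [Fintype.card_fin] at this
  exact this hdim
end

section
variable {k : Type} [Field k]

theorem exists_pairing {L L' : Type} [Field L] [CommRing L'] [Algebra k L] [Algebra k L']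
    (c : L' ≃ₐ[k] L) {ξ : L} {ξ' : L'} (h : ξ * c ξ' = 1) :
    ∃ T : L →ₗ[k] L' →ₗ[k] k, (∀ x y, T (ξ * x) (ξ' * y) = T x y) ∧
      (∀ x, (∀ y, T x y = 0) → x = 0) ∧ (∀ y, (∀ x, T x y = 0) → y = 0) := by
  obtain ⟨s, hs⟩ := Module.Projective.exists_dual_eq_one k (one_ne_zero : (1 : L) ≠ 0)
  let T : L →ₗ[k] L' →ₗ[k] k := ((LinearMap.mul k L).compl₂ (c : L' →ₐ[k] L).toLinearMap).compr₂ s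
  have hT : ∀ x y, T x y = s (x * c y) := fun x y => rfl
  have hs0 : s 1 ≠ 0 := by rw [hs]; exact one_ne_zero
  refine ⟨T, fun x y => ?_, fun x hx => ?_, fun y hy => ?_⟩
  · rw [hT, hT, map_mul c]
    congr 1
    linear_combination (x * c y) * h
  · by_contra hx0
    apply hs0
    rw [← hx (c.symm x⁻¹), hT, c.apply_symm_apply, mul_inv_cancel₀ hx0]
  · by_contra hy0
    have hc0 : c y ≠ 0 := fun h => hy0 (c.injective (by rw [h, map_zero]))
    apply hs0
    rw [← hy (c y)⁻¹, hT, inv_mul_cancel₀ hc0]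

variable {L : Type} [Field L] [Algebra k L]

/-- The elements fixed by `c`. -/
def fixedSubmodule (c : L →ₐ[k] L) : Submodule k L := LinearMap.eqLocus c.toLinearMap LinearMap.id

theorem mem_fixedSubmodule {c : L →ₐ[k] L} {x : L} : x ∈ fixedSubmodule c ↔ c x = x := Iff.rfl

/-- The hermitian trace forms `(x, y) ↦ s (w x c(y))`, for `w` fixed by `c`. -/
def hermForm (c : L →ₐ[k] L) (s : L →ₗ[k] k) :
    fixedSubmodule c →ₗ[k] LinearMap.BilinForm k L where
  toFun w := ((LinearMap.mul k L).compl₁₂ (LinearMap.mulLeft k (w : L)) c.toLinearMap).compr₂ s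
  map_add' w w' := by ext; simp [add_mul]
  map_smul' a w := by ext; simp

theorem hermForm_apply (c : L →ₐ[k] L) (s : L →ₗ[k] k) (w : fixedSubmodule c) (x y : L) :
    hermForm c s w x y = s (w * x * c y) := rfl

variable {c : L →ₐ[k] L} {s : L →ₗ[k] k}

theorem exists_invariant_functional (h2 : (2 : k) ≠ 0) (hc : ∀ x, c (c x) = x) :
    ∃ s : L →ₗ[k] k, (∀ x, s (c x) = s x) ∧ s 1 ≠ 0 := by
  obtain ⟨t, ht⟩ := Module.Projective.exists_dual_eq_one k (one_ne_zero : (1 : L) ≠ 0)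
  refine ⟨t + t ∘ₗ c.toLinearMap, fun x => ?_, ?_⟩
  · simp [hc, add_comm]
  · simp only [LinearMap.add_apply, LinearMap.comp_apply, AlgHom.toLinearMap_apply, map_one, ht]
    norm_num [h2]

theorem hermForm_symm (hc : ∀ x, c (c x) = x) (hs : ∀ x, s (c x) = s x)
    (w : fixedSubmodule c) (x y : L) : hermForm c s w x y = hermForm c s w y x := by
  have hw : c w = w := w.2
  rw [hermForm_apply, hermForm_apply, ← hs, map_mul c, map_mul c, hc, hw]
  ring_nf

theorem hermForm_nondeg (hc : ∀ x, c (c x) = x) (hs1 : s 1 ≠ 0)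
    (w : fixedSubmodule c) (hw : w ≠ 0) (x : L) (h : ∀ y, hermForm c s w x y = 0) : x = 0 := by
  by_contra hx
  have hw0 : (w : L) ≠ 0 := fun h => hw (Subtype.ext h)
  apply hs1
  rw [← h (c (w * x)⁻¹), hermForm_apply, hc, mul_inv_cancel₀ (mul_ne_zero hw0 hx)]

theorem hermForm_aniso (hc : ∀ x, c (c x) = x) (hs1 : s 1 ≠ 0) (x : L) (hx : x ≠ 0) :
    ∃ w, hermForm c s w x x ≠ 0 := by
  have hcx : c x ≠ 0 := (_root_.map_ne_zero c).2 hx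
  refine ⟨⟨(x * c x)⁻¹, ?_⟩, ?_⟩
  · rw [mem_fixedSubmodule, map_inv₀, map_mul, hc, mul_comm]
  · rw [hermForm_apply, mul_assoc, inv_mul_cancel₀ (mul_ne_zero hx hcx)]
    exact hs1

theorem hermForm_inv (w : fixedSubmodule c) {ξ : L} (h : ξ * c ξ = 1) (x y : L) :
    hermForm c s w (ξ * x) (ξ * y) = hermForm c s w x y := by
  rw [hermForm_apply, hermForm_apply, map_mul c]
  congr 1
  linear_combination (w * x * c y) * h

theorem hermForm_eq_one_mul (w : fixedSubmodule c) (x y : L) :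
    hermForm c s w x y =
      hermForm c s ⟨1, map_one c⟩ (LinearMap.mulLeft k (w : L) x) y := by
  rw [hermForm_apply, hermForm_apply, one_mul, LinearMap.mulLeft_apply]

/-- A nontrivial involution splits the space into two copies of the fixed space. -/
theorem exists_fixedSubmodule_equiv (h2 : (2 : k) ≠ 0) (hc : ∀ x, c (c x) = x) {δ : L}
    (hδ0 : δ ≠ 0) (hδ : c δ = -δ) :
    ∃ e : (fixedSubmodule c × fixedSubmodule c) ≃ₗ[k] L, ∀ p, e p = p.1 + δ * p.2 := by
  have h2' : (2 : L) ≠ 0 := by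
    rw [← map_ofNat (algebraMap k L)]
    exact (_root_.map_ne_zero _).2 h2
  let e : (fixedSubmodule c × fixedSubmodule c) →ₗ[k] L :=
    (fixedSubmodule c).subtype.coprod ((LinearMap.mulLeft k δ).comp (fixedSubmodule c).subtype)
  have he : ∀ p, e p = p.1 + δ * p.2 := fun p => rfl
  refine ⟨LinearEquiv.ofBijective e ⟨?_, fun x => ?_⟩, he⟩
  · rw [← LinearMap.ker_eq_bot, LinearMap.ker_eq_bot']
    rintro ⟨⟨a, ha⟩, ⟨b, hb⟩⟩ h
    rw [mem_fixedSubmodule] at ha hb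
    rw [he] at h
    simp only at h
    have h' := congrArg c h
    rw [map_add, map_mul, ha, hb, hδ, map_zero] at h'
    have ha0 : a = 0 := by
      refine (mul_eq_zero.1 (?_ : 2 * a = 0)).resolve_left h2'
      linear_combination h + h'
    have hb0 : b = 0 := by
      rw [ha0, zero_add] at h
      exact (mul_eq_zero.1 h).resolve_left hδ0
    simp [ha0, hb0]
  · refine ⟨(⟨(x + c x) / 2, ?_⟩, ⟨(x - c x) / (2 * δ), ?_⟩), ?_⟩
    · rw [mem_fixedSubmodule, map_div₀, map_add, hc, map_ofNat, add_comm]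
    · rw [mem_fixedSubmodule, map_div₀, map_sub, map_mul, hc, map_ofNat, hδ]
      field_simp
      ring
    · rw [he]
      field_simp
      ring

theorem finrank_eq_two_mul_fixedSubmodule [FiniteDimensional k L] (h2 : (2 : k) ≠ 0)
    (hc : ∀ x, c (c x) = x) {δ : L} (hδ0 : δ ≠ 0) (hδ : c δ = -δ) :
    Module.finrank k L = 2 * Module.finrank k (fixedSubmodule c) := by
  obtain ⟨e, -⟩ := exists_fixedSubmodule_equiv h2 hc hδ0 hδ
  rw [← e.finrank_eq, Module.finrank_prod, two_mul]

theorem exists_det_mulLeft_eq_sq [FiniteDimensional k L] (h2 : (2 : k) ≠ 0)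
    (hc : ∀ x, c (c x) = x) {δ : L} (hδ0 : δ ≠ 0) (hδ : c δ = -δ) (w : fixedSubmodule c) :
    ∃ r, LinearMap.det (LinearMap.mulLeft k (w : L)) = r ^ 2 := by
  obtain ⟨e, he⟩ := exists_fixedSubmodule_equiv h2 hc hδ0 hδ
  have hw : c w = w := w.2
  let m : fixedSubmodule c →ₗ[k] fixedSubmodule c :=
    (LinearMap.mulLeft k (w : L)).restrict fun x hx => by
      rw [mem_fixedSubmodule] at hx ⊢
      rw [LinearMap.mulLeft_apply, map_mul, hx, hw]
  refine ⟨LinearMap.det m, ?_⟩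
  rw [sq, ← LinearMap.det_prodMap, ← LinearMap.det_conj _ e]
  congr 1
  ext x
  obtain ⟨p, rfl⟩ := e.surjective x
  simp only [LinearMap.comp_apply, LinearEquiv.coe_coe, LinearEquiv.symm_apply_apply]
  simp only [LinearMap.mulLeft_apply, he, LinearMap.prodMap_apply, m,
    LinearMap.coe_restrict_apply]
  ring
end

section
variable {k : Type} [Field k]

theorem starPoly_starPoly {f : k[X]} (hm : f.Monic) (h0 : f.coeff 0 ≠ 0) :
    starPoly (starPoly f) = f := by
  have hrr : f.reverse.reverse = f := by
    have : f.reverse.natDegree = f.natDegree := by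
      rw [reverse_natDegree, natTrailingDegree_eq_zero.2 (Or.inr h0), Nat.sub_zero]
    rw [reverse, this, reverse, reflect_reflect]
  have hc : (starPoly f).coeff 0 = (f.coeff 0)⁻¹ := by
    rw [starPoly, coeff_C_mul, coeff_zero_reverse, hm.leadingCoeff, mul_one]
  rw [starPoly, hc, inv_inv, starPoly, reverse_mul_of_domain, reverse_C, hrr, ← mul_assoc, ← C_mul,
    mul_inv_cancel₀ h0, C_1, one_mul]

/-- The quotient `k[X]/(f)`. -/
abbrev PolyQuot (f : k[X]) : Type := k[X] ⧸ Ideal.span {f}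

/-- The class of `X` in `k[X]/(f)`. -/
def PolyQuot.root (f : k[X]) : PolyQuot f := Ideal.Quotient.mk _ X

namespace PolyQuot

theorem X_smul {f : k[X]} (x : PolyQuot f) : (X : k[X]) • x = root f * x := by
  obtain ⟨p, rfl⟩ := Ideal.Quotient.mk_surjective x
  rfl

theorem aeval_root (f p : k[X]) : aeval (root f) p = Ideal.Quotient.mk _ p := by
  have : aeval (root f) = Ideal.Quotient.mkₐ k (Ideal.span {f}) := by
    apply Polynomial.algHom_ext
    rw [aeval_X]
    rfl
  rw [this]
  rfl

theorem aeval_root_self (f : k[X]) : aeval (root f) f = 0 := by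
  rw [aeval_root, Ideal.Quotient.eq_zero_iff_mem]
  exact Ideal.mem_span_singleton_self f

theorem algHom_ext {f : k[X]} {A : Type} [CommRing A] [Algebra k A] {φ ψ : PolyQuot f →ₐ[k] A}
    (h : φ (root f) = ψ (root f)) : φ = ψ := by
  apply Ideal.Quotient.algHom_ext
  apply Polynomial.algHom_ext
  exact h

/-- `k[X]/(f)` is a field for irreducible `f`. -/
@[reducible]
def field {f : k[X]} (hf : Irreducible f) : Field (PolyQuot f) :=
  have := PrincipalIdealRing.isMaximal_of_irreducible hf
  Ideal.Quotient.field _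

theorem finiteDimensional {f : k[X]} (hf : f.Monic) : FiniteDimensional k (PolyQuot f) :=
  hf.finite_quotient

theorem finrank_eq (f : k[X]) : Module.finrank k (PolyQuot f) = f.natDegree :=
  finrank_quotient_span_eq_natDegree

theorem exists_algHom {f : k[X]} (hf : Irreducible f) (h0 : f.coeff 0 ≠ 0) :
    ∃ c : PolyQuot (starPoly f) →ₐ[k] PolyQuot f, root f * c (root (starPoly f)) = 1 := by
  let := field hf
  have hξ : root f ≠ 0 := fun h => by
    have h' := aeval_root_self f
    rw [h, ← coeff_zero_eq_aeval_zero', map_eq_zero_iff _ (algebraMap k (PolyQuot f)).injective]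
      at h'
    exact h0 h'
  have hstar : aeval (root f)⁻¹ (starPoly f) = 0 := by
    let := invertibleOfNonzero hξ
    have hrev : aeval (⅟(root f)) f.reverse = 0 :=
      (eval₂_reverse_eq_zero_iff (algebraMap k _) (root f) f).2 (aeval_root_self f)
    rw [starPoly, map_mul, ← invOf_eq_inv (root f), hrev, mul_zero]
  refine ⟨Ideal.Quotient.liftₐ _ (aeval (root f)⁻¹) fun p hp => ?_, ?_⟩
  · obtain ⟨q, rfl⟩ := Ideal.mem_span_singleton.1 hp
    rw [map_mul, hstar, zero_mul]
  · have : Ideal.Quotient.liftₐ (Ideal.span {starPoly f}) (aeval (root f)⁻¹) (fun p hp => by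
      obtain ⟨q, rfl⟩ := Ideal.mem_span_singleton.1 hp
      rw [map_mul, hstar, zero_mul]) (root (starPoly f)) = (root f)⁻¹ := aeval_X _
    rw [this, mul_inv_cancel₀ hξ]

theorem algHom_apply_apply {f g : k[X]} {c : PolyQuot g →ₐ[k] PolyQuot f}
    {c' : PolyQuot f →ₐ[k] PolyQuot g} (h : root f * c (root g) = 1)
    (h' : root g * c' (root f) = 1) (x : PolyQuot f) : c (c' x) = x := by
  have : c.comp c' = AlgHom.id k (PolyQuot f) := by
    apply algHom_ext
    have h'' := congrArg c h'
    rw [map_mul, map_one] at h''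
    exact (left_inv_eq_right_inv h h'').symm
  exact DFunLike.congr_fun this x

theorem exists_algEquiv {f g : k[X]} (hm : f.Monic) (hf : Irreducible f) (hg : Irreducible g)
    (hf0 : f.coeff 0 ≠ 0) (hg0 : g.coeff 0 ≠ 0) (hfg : g = starPoly f) :
    ∃ c : PolyQuot g ≃ₐ[k] PolyQuot f, root f * c (root g) = 1 := by
  have hgf : f = starPoly g := by rw [hfg, starPoly_starPoly hm hf0]
  obtain ⟨c, hc⟩ : ∃ c : PolyQuot g →ₐ[k] PolyQuot f, root f * c (root g) = 1 := by
    rw [hfg]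
    exact exists_algHom hf hf0
  obtain ⟨c', hc'⟩ : ∃ c : PolyQuot f →ₐ[k] PolyQuot g, root g * c (root f) = 1 := by
    have := exists_algHom hg hg0
    rwa [← hgf] at this
  exact ⟨AlgEquiv.ofAlgHom c c' (AlgHom.ext (algHom_apply_apply hc hc'))
    (AlgHom.ext (algHom_apply_apply hc' hc)), hc⟩

theorem exists_involution {f : k[X]} (hf : Irreducible f) (h0 : f.coeff 0 ≠ 0)
    (hs : f = starPoly f) :
    ∃ c : PolyQuot f →ₐ[k] PolyQuot f, root f * c (root f) = 1 ∧ ∀ x, c (c x) = x := by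
  have := exists_algHom hf h0
  rw [← hs] at this
  obtain ⟨c, hc⟩ := this
  exact ⟨c, hc, algHom_apply_apply hc hc⟩

theorem natDegree_le_one_of_root_sq {f : k[X]} (hf : Irreducible f)
    (h : root f * root f = 1) : f.natDegree ≤ 1 := by
  let := field hf
  have key : ∀ a : k, root f = algebraMap k _ a → f.natDegree ≤ 1 := fun a ha => by
    have hdvd : f ∣ X - C a := by
      rw [← Ideal.mem_span_singleton, ← Ideal.Quotient.eq_zero_iff_mem, map_sub]
      exact sub_eq_zero.2 ha
    exact (natDegree_le_of_dvd hdvd (X_sub_C_ne_zero a)).trans (natDegree_X_sub_C a).le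
  rcases mul_self_eq_one_iff.1 h with h | h
  · exact key 1 (by rw [h, map_one])
  · exact key (-1) (by rw [h, map_neg, map_one])

end PolyQuot

/-- A nondegenerate symmetric form for which multiplication by `X` is an isometry. -/
structure IsGoodForm {M : Type} [AddCommGroup M] [Module k M] [Module k[X] M]
    (B : LinearMap.BilinForm k M) : Prop where
  symm : ∀ x y, B x y = B y x
  nondeg : ∀ x, (∀ y, B x y = 0) → x = 0
  inv : ∀ x y, B ((X : k[X]) • x) ((X : k[X]) • y) = B x y

theorem PolyQuot.exists_family {f : k[X]} (h2 : (2 : k) ≠ 0) (hm : f.Monic) (hf : Irreducible f)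
    (h0 : f.coeff 0 ≠ 0) (hs : f = starPoly f) (hev : Even f.natDegree) :
    ∃ (W : Submodule k (PolyQuot f)) (β : W →ₗ[k] LinearMap.BilinForm k (PolyQuot f)) (w₁ : W)
      (N : W → PolyQuot f →ₗ[k] PolyQuot f) (r : W → k),
      (∀ w, w ≠ 0 → IsGoodForm (β w)) ∧ (∀ w x y, β w x y = β w y x) ∧
      (∀ x, x ≠ 0 → ∃ w, β w x x ≠ 0) ∧ w₁ ≠ 0 ∧
      (∀ w x y, β w x y = β w₁ (N w x) y) ∧ (∀ w, LinearMap.det (N w) = r w ^ 2) ∧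
      Module.finrank k (PolyQuot f) = 2 * Module.finrank k W := by
  let := field hf
  have := finiteDimensional hm
  obtain ⟨c, hroot, hc⟩ := exists_involution hf h0 hs
  obtain ⟨s, hcs, hs1⟩ := exists_invariant_functional h2 hc
  have hδ0 : root f - c (root f) ≠ 0 := fun h => by
    rw [sub_eq_zero] at h
    rw [← h] at hroot
    have h1 := natDegree_le_one_of_root_sq hf hroot
    have h2 := hf.natDegree_pos
    obtain ⟨m, hm⟩ := hev
    omega
  have hδ : c (root f - c (root f)) = -(root f - c (root f)) := by
    rw [map_sub, hc, neg_sub]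
  choose r hr using exists_det_mulLeft_eq_sq h2 hc hδ0 hδ
  refine ⟨fixedSubmodule c, hermForm c s, ⟨1, map_one c⟩,
    fun w => LinearMap.mulLeft k (w : PolyQuot f), r, fun w hw => ⟨hermForm_symm hc hcs w,
      hermForm_nondeg hc hs1 w hw, fun x y => ?_⟩, hermForm_symm hc hcs, hermForm_aniso hc hs1,
      fun h => one_ne_zero (congrArg Subtype.val h), hermForm_eq_one_mul, hr,
      finrank_eq_two_mul_fixedSubmodule h2 hc hδ0 hδ⟩
  rw [X_smul, X_smul, hermForm_inv w hroot]

theorem PolyQuot.exists_isGoodForm {f : k[X]} (h2 : (2 : k) ≠ 0) (hf : Irreducible f)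
    (h0 : f.coeff 0 ≠ 0) (hs : f = starPoly f) :
    ∃ B : LinearMap.BilinForm k (PolyQuot f), IsGoodForm B := by
  let := field hf
  obtain ⟨c, hroot, hc⟩ := exists_involution hf h0 hs
  obtain ⟨s, hcs, hs1⟩ := exists_invariant_functional h2 hc
  let w : fixedSubmodule c := ⟨1, map_one c⟩
  have hw : w ≠ 0 := fun h => one_ne_zero (congrArg Subtype.val h)
  refine ⟨hermForm c s w, hermForm_symm hc hcs w, hermForm_nondeg hc hs1 w hw, fun x y => ?_⟩
  rw [X_smul, X_smul, hermForm_inv w hroot]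

theorem PolyQuot.exists_pairing {f g : k[X]} (hm : f.Monic) (hf : Irreducible f)
    (hg : Irreducible g) (hf0 : f.coeff 0 ≠ 0) (hg0 : g.coeff 0 ≠ 0) (hfg : g = starPoly f) :
    ∃ T : PolyQuot f →ₗ[k] PolyQuot g →ₗ[k] k,
      (∀ x y, T ((X : k[X]) • x) ((X : k[X]) • y) = T x y) ∧
      (∀ x, (∀ y, T x y = 0) → x = 0) ∧ (∀ y, (∀ x, T x y = 0) → y = 0) := by
  let := field hf
  obtain ⟨c, hc⟩ := exists_algEquiv hm hf hg hf0 hg0 hfg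
  obtain ⟨T, hT, hT'⟩ := _root_.exists_pairing c hc
  exact ⟨T, fun x y => by rw [X_smul, X_smul, hT], hT'⟩
end

section
variable {k : Type} [Field k]

namespace IsGoodForm

section
variable {M N : Type} [AddCommGroup M] [Module k M] [Module k[X] M]
  [AddCommGroup N] [Module k N] [Module k[X] N]

theorem prodForm {B : LinearMap.BilinForm k M} {C : LinearMap.BilinForm k N} (hB : IsGoodForm B)
    (hC : IsGoodForm C) : IsGoodForm (prodForm B C) where
  symm x y := by simp only [prodForm_apply]; rw [hB.symm, hC.symm]
  nondeg x h := Prod.ext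
    (hB.nondeg _ fun y => by simpa using h (y, 0)) (hC.nondeg _ fun y => by simpa using h (0, y))
  inv x y := by
    simp only [prodForm_apply, Prod.smul_fst, Prod.smul_snd]
    rw [hB.inv, hC.inv]

theorem smul {B : LinearMap.BilinForm k M} (hB : IsGoodForm B) {d : k} (hd : d ≠ 0) :
    IsGoodForm (d • B) where
  symm x y := by simp [hB.symm x y]
  nondeg x h := hB.nondeg x fun y => (mul_eq_zero.1 (h y)).resolve_left hd
  inv x y := by simp [hB.inv x y]

theorem compl₁₂ {B : LinearMap.BilinForm k N} (hB : IsGoodForm B) (e : M ≃ₗ[k] N)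
    (he : ∀ x : M, e ((X : k[X]) • x) = (X : k[X]) • e x) :
    IsGoodForm (B.compl₁₂ (e : M →ₗ[k] N) (e : M →ₗ[k] N)) where
  symm x y := hB.symm _ _
  nondeg x h := by
    rw [← e.map_eq_zero_iff]
    refine hB.nondeg _ fun y => ?_
    simpa using h (e.symm y)
  inv x y := by simp [he, hB.inv]

end

variable {I : Type} [Finite I] {M : I → Type} [∀ i, AddCommGroup (M i)] [∀ i, Module k (M i)]
  [∀ i, Module k[X] (M i)]

theorem exists_pi (h : ∀ i, ∃ B : LinearMap.BilinForm k (M i), IsGoodForm B) :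
    ∃ B : LinearMap.BilinForm k (∀ i, M i), IsGoodForm B := by
  classical
  have := Fintype.ofFinite I
  choose b hb using h
  let B : LinearMap.BilinForm k (∀ i, M i) :=
    ∑ i, (b i).compl₁₂ (LinearMap.proj i) (LinearMap.proj i)
  have hB : ∀ x y, B x y = ∑ i, b i (x i) (y i) := fun x y => by
    simp [B, LinearMap.sum_apply]
  refine ⟨B, fun x y => ?_, fun x h => funext fun i => (hb i).nondeg _ fun z => ?_,
    fun x y => ?_⟩
  · rw [hB, hB]
    exact Finset.sum_congr rfl fun i _ => (hb i).symm _ _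
  · have := h (Pi.single i z)
    rw [hB, Finset.sum_eq_single i (fun j _ hj => by rw [Pi.single_eq_of_ne hj, map_zero])
      (by simp), Pi.single_eq_same] at this
    exact this
  · rw [hB, hB]
    exact Finset.sum_congr rfl fun i _ => (hb i).inv _ _

theorem exists_pi_of_pairing (τ : Equiv.Perm I) (H : I → Prop) (hH : ∀ i, H (τ i) ↔ ¬ H i)
    (h : ∀ i, ∃ T : M i →ₗ[k] M (τ i) →ₗ[k] k,
      (∀ x y, T ((X : k[X]) • x) ((X : k[X]) • y) = T x y) ∧
      (∀ x, (∀ y, T x y = 0) → x = 0) ∧ (∀ y, (∀ x, T x y = 0) → y = 0)) :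
    ∃ B : LinearMap.BilinForm k (∀ i, M i), IsGoodForm B := by
  classical
  have := Fintype.ofFinite I
  choose T hT hTl hTr using h
  let b : ∀ i, LinearMap.BilinForm k (∀ i, M i) :=
    fun i => (T i).compl₁₂ (LinearMap.proj i) (LinearMap.proj (τ i))
  let B : LinearMap.BilinForm k (∀ i, M i) := ∑ i : {i // H i}, (b i + (b i).flip)
  have hB : ∀ x y, B x y =
      ∑ i : {i // H i}, (T i (x i) (y (τ i)) + T i (y i) (x (τ i))) := fun x y => by
    simp [B, b, LinearMap.sum_apply]
  refine ⟨B, fun x y => ?_, fun x h => ?_, fun x y => ?_⟩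
  · rw [hB, hB]
    exact Finset.sum_congr rfl fun i _ => add_comm _ _
  · have h1 : ∀ i, H i → x i = 0 := fun i hi => by
      refine hTl i _ fun z => ?_
      have := h (Pi.single (τ i) z)
      rw [hB, Finset.sum_eq_single ⟨i, hi⟩] at this
      · have hne : i ≠ τ i := fun h => (hH i).1 (h ▸ hi) hi
        simpa [Pi.single_eq_of_ne hne] using this
      · intro j _ hj
        have h1 : τ j ≠ τ i := fun h => hj (Subtype.ext (τ.injective h))
        have h2 : (j : I) ≠ τ i := fun h => (hH i).1 (h ▸ j.2) hi
        simp [Pi.single_eq_of_ne h1, Pi.single_eq_of_ne h2]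
      · simp
    have h2 : ∀ i, H i → x (τ i) = 0 := fun i hi => by
      refine hTr i _ fun z => ?_
      have := h (Pi.single i z)
      rw [hB, Finset.sum_eq_single ⟨i, hi⟩] at this
      · have hne : τ i ≠ i := fun h => (hH i).1 (h.symm ▸ hi) hi
        simpa [Pi.single_eq_of_ne hne] using this
      · intro j _ hj
        have h1 : (j : I) ≠ i := fun h => hj (Subtype.ext h)
        have h2 : τ j ≠ i := fun h => (hH j).1 (h ▸ hi) j.2
        simp [Pi.single_eq_of_ne h1, Pi.single_eq_of_ne h2]
      · simp
    funext i
    by_cases hi : H i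
    · exact h1 i hi
    · have hi' : H (τ.symm i) := by
        have := hH (τ.symm i)
        rw [τ.apply_symm_apply] at this
        tauto
      have := h2 _ hi'
      rwa [τ.apply_symm_apply] at this
  · rw [hB, hB]
    exact Finset.sum_congr rfl fun i _ => by simp only [Pi.smul_apply, hT]

end IsGoodForm

/-- Splitting off two factors of a product, and dividing the other ones in two classes. -/
theorem exists_piEquiv_split {R P : Type} [Semiring R] {M : P → Type} [∀ p, AddCommGroup (M p)]
    [∀ p, Module R (M p)] (S : P → Prop) {p₁ p₀ : P} (h₁ : S p₁) (h₀ : S p₀) (hne : p₁ ≠ p₀) :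
    Nonempty ((∀ p, M p) ≃ₗ[R] M p₁ × (M p₀ × ((∀ p : {p // S p ∧ p ≠ p₁ ∧ p ≠ p₀}, M p) ×
      (∀ p : {p // ¬ S p}, M p)))) := by
  classical
  refine ⟨LinearEquiv.ofBijective
    ((LinearMap.proj p₁).prod ((LinearMap.proj p₀).prod
      ((LinearMap.pi fun p => LinearMap.proj p.1).prod
        (LinearMap.pi fun p => LinearMap.proj p.1)))) ⟨?_, ?_⟩⟩
  · intro x y h
    funext p
    have e1 : x p₁ = y p₁ := congrArg (fun z => z.1) h
    have e0 : x p₀ = y p₀ := congrArg (fun z => z.2.1) h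
    have es := congrArg (fun z => z.2.2.1) h
    have en := congrArg (fun z => z.2.2.2) h
    by_cases hp1 : p = p₁
    · rw [hp1, e1]
    by_cases hp0 : p = p₀
    · rw [hp0, e0]
    by_cases hS : S p
    · exact congrFun es ⟨p, hS, hp1, hp0⟩
    · exact congrFun en ⟨p, hS⟩
  · rintro ⟨a, b, u, v⟩
    refine ⟨fun p => if h : p = p₁ then h ▸ a else if h : p = p₀ then h ▸ b else
      if h' : S p then u ⟨p, h', ‹_›, ‹_›⟩ else v ⟨p, h'⟩, ?_⟩
    refine Prod.ext ?_ (Prod.ext ?_ (Prod.ext (funext fun p => ?_) (funext fun p => ?_)))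
    · simp
    · simp [hne.symm]
    · obtain ⟨p, hS, hp1, hp0⟩ := p
      simp [hS, hp1, hp0]
    · obtain ⟨p, hS⟩ := p
      have hp1 : p ≠ p₁ := fun h => hS (h ▸ h₁)
      have hp0 : p ≠ p₀ := fun h => hS (h ▸ h₀)
      simp [hS, hp1, hp0]
end

section
variable {k : Type} [Field k]

theorem coeff_zero_ne_zero_of_starPoly_monic {f : k[X]} (h : (starPoly f).Monic) :
    f.coeff 0 ≠ 0 := fun h0 => by
  apply h.ne_zero
  rw [starPoly, h0, inv_zero, C_0, zero_mul]

theorem starPoly_X_add_C {a : k} (ha : a * a = 1) : starPoly (X + C a) = X + C a := by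
  have hinv : a⁻¹ = a := inv_eq_of_mul_eq_one_right ha
  have hrev : (X + C a).reverse = C a * X + 1 := by
    have hX : (X : k[X]).reverse = 1 := by
      rw [← one_mul (X : k[X]), reverse_mul_X, ← C_1, reverse_C]
    rw [reverse_add_C, hX, natDegree_X, pow_one, add_comm]
  rw [starPoly, hrev, coeff_add, coeff_X_zero, coeff_C_zero, zero_add, hinv, mul_add, ← mul_assoc,
    ← C_mul, ha]
  simp

theorem IsPhaseFunction.exists_isGoodForm_equiv {γ : k → ℂ} (hγ : IsPhaseFunction γ)
    (h2 : (2 : k) ≠ 0) {P : Type} [Finite P] (F : P → k[X]) (hm : ∀ p, (F p).Monic)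
    (hirr : ∀ p, Irreducible (F p)) (τ : Equiv.Perm P) (hτ : ∀ p, F (τ p) = starPoly (F p))
    {p₁ p₀ : P} (h₁ : F p₁ = starPoly (F p₁)) (hev : Even (F p₁).natDegree)
    (h₀ : F p₀ = starPoly (F p₀)) (hdeg : (F p₀).natDegree = 1)
    {V : Type} [AddCommGroup V] [Module k V] [FiniteDimensional k V]
    (B : LinearMap.BilinForm k V) (hB : IsQuadraticSpace B)
    (hV : Module.finrank k V = Module.finrank k (∀ p, PolyQuot (F p))) :
    ∃ (C : LinearMap.BilinForm k (∀ p, PolyQuot (F p))) (Φ : V ≃ₗ[k] ∀ p, PolyQuot (F p)),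
      IsGoodForm C ∧ ∀ x y, C (Φ x) (Φ y) = B x y := by
  have hfin : ∀ p, FiniteDimensional k (PolyQuot (F p)) :=
    fun p => PolyQuot.finiteDimensional (hm p)
  have hF0 : ∀ p, (F p).coeff 0 ≠ 0 := fun p =>
    coeff_zero_ne_zero_of_starPoly_monic (hτ p ▸ hm (τ p))
  have hττ : ∀ p, F (τ (τ p)) = F p := fun p => by
    rw [hτ, hτ, starPoly_starPoly (hm p) (hF0 p)]
  have hne : p₁ ≠ p₀ := fun h => by
    rw [h, hdeg] at hev
    exact absurd hev (by decide)
  let S : P → Prop := fun p => F p = starPoly (F p)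
  obtain ⟨e⟩ := exists_piEquiv_split (R := k[X]) (M := fun p => PolyQuot (F p)) S h₁ h₀ hne
  obtain ⟨Gs, hGs⟩ := IsGoodForm.exists_pi (M := fun p : {p // S p ∧ p ≠ p₁ ∧ p ≠ p₀} =>
    PolyQuot (F p)) fun p => PolyQuot.exists_isGoodForm h2 (hirr p) (hF0 p) p.2.1
  have hS : ∀ p, ¬ S (τ p) ↔ ¬ S p := fun p => by
    simp only [S]
    rw [← hτ, ← hτ, hττ, eq_comm]
  obtain ⟨Gn, hGn⟩ := IsGoodForm.exists_pi_of_pairing (M := fun p : {p // ¬ S p} => PolyQuot (F p))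
    (τ.subtypePerm hS) (fun p => WellOrderingRel (F p) (F (τ p)))
    (fun p => by
      have hne : F (τ p) ≠ F p := fun h => p.2 (h.symm.trans (hτ p))
      simp only [Equiv.Perm.subtypePerm_apply, hττ]
      refine ⟨fun h h' => asymm h h', fun h => ?_⟩
      rcases trichotomous_of WellOrderingRel (F (τ p)) (F p) with h' | h' | h'
      · exact h'
      · exact absurd h' hne
      · exact absurd h' h)
    fun p => PolyQuot.exists_pairing (hm p) (hirr p) (hirr _) (hF0 p) (hF0 _) (hτ p)
  obtain ⟨B₀, hB₀⟩ := PolyQuot.exists_isGoodForm h2 (hirr p₀) (hF0 p₀) h₀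
  obtain ⟨W, β, w₁, N, r, hgood, hβ, hβan, hw₁, hN, hr, hdim⟩ :=
    PolyQuot.exists_family h2 (hm p₁) (hirr p₁) (hF0 p₁) h₁ hev
  have hG := hGs.prodForm hGn
  have hVdim := hV.trans (e.restrictScalars k).finrank_eq
  rw [Module.finrank_prod, Module.finrank_prod] at hVdim
  obtain ⟨w, hw, d, hd, Φ, hΦ⟩ := hγ.exists_equiv_prodForm h2 β hβ
    (fun w hw => (hgood w hw).nondeg) hβan w₁ hw₁ N hN r hr hdim B₀ hB₀.symm hB₀.nondeg
    ((PolyQuot.finrank_eq _).trans hdeg) (prodForm Gs Gn) hG.symm hG.nondeg B hB.1 hB.2 hVdim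
  refine ⟨_, Φ.trans (e.restrictScalars k).symm,
    ((hgood w hw).prodForm ((hB₀.smul hd).prodForm hG)).compl₁₂ (e.restrictScalars k)
      fun x => e.map_smul _ _, fun x y => ?_⟩
  rw [← hΦ]
  simp only [LinearMap.compl₁₂_apply, LinearEquiv.coe_coe, LinearEquiv.trans_apply,
    LinearEquiv.apply_symm_apply]

theorem hasIsometryWithModule_of_isGoodForm {V : Type} [AddCommGroup V] [Module k V]
    {B : LinearMap.BilinForm k V} {D : ModuleData k}
    [FiniteDimensional k V]
    {C : LinearMap.BilinForm k (D.SpaceVia (RingHom.id k))} (hC : IsGoodForm C)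
    (Φ : V ≃ₗ[k] D.SpaceVia (RingHom.id k)) (hΦ : ∀ x y, C (Φ x) (Φ y) = B x y) :
    HasIsometryWithModule B D := by
  have hfin : FiniteDimensional k (D.SpaceVia (RingHom.id k)) := Φ.finiteDimensional
  let T : D.SpaceVia (RingHom.id k) →ₗ[k] D.SpaceVia (RingHom.id k) :=
    Algebra.lsmul k k _ (X : k[X])
  have hT : ∀ x, T x = (X : k[X]) • x := fun x => rfl
  have hinj : Function.Injective T := by
    rw [← LinearMap.ker_eq_bot, LinearMap.ker_eq_bot']
    intro x hx
    refine hC.nondeg x fun y => ?_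
    rw [← hC.inv, ← hT x, hx, map_zero, LinearMap.zero_apply]
  let T' := LinearEquiv.ofInjectiveEndo T hinj
  have hT' : ∀ x, T' x = (X : k[X]) • x := fun x => rfl
  refine ⟨Φ.trans (T'.trans Φ.symm), fun x y => ?_, Φ, fun w => ?_⟩
  · rw [← hΦ, ← hΦ]
    simp only [LinearEquiv.trans_apply, LinearEquiv.apply_symm_apply, hT', hC.inv]
  · simp only [LinearEquiv.trans_apply, LinearEquiv.apply_symm_apply, hT']
end

/-- **Cor. 7.3.** Over a non-archimedean local field `k`, if `M` is
semi-simple with `M¹ ≠ 0` and `M⁰ ≠ 0`, then every quadratic space of dimension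
`dim_k M` has an isometry with module `M`. -/
theorem hasIsometryWithModule_of_localField_M0_ne_zero
    {k : Type} [Field k] [Valued k (WithZero (Multiplicative ℤ))] [CompleteSpace k]
    (hdisc : Function.Surjective
      (Valued.v : Valuation k (WithZero (Multiplicative ℤ))))
    (hres : Finite (Valued.ResidueField k))
    (hchar : (2 : k) ≠ 0)
    (D : ModuleData k) (hss : D.Semisimple) (hM1 : ∃ i, D.IsIdx1 i)
    (hM0 : ∃ i, D.IsIdx0 i) :
    ∀ (V : Type) [AddCommGroup V] [Module k V] [FiniteDimensional k V]
      (B : LinearMap.BilinForm k V), IsQuadraticSpace B →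
      Module.finrank k V = D.dim → HasIsometryWithModule B D := by
  intro V _ _ _ B hB hV
  obtain ⟨γ, hγ⟩ := exists_isPhaseFunction hdisc hres hchar
  obtain ⟨σ, hσ⟩ := D.selfdual
  obtain ⟨i₁, hsym, hev⟩ := hM1
  obtain ⟨i₀, hi₀⟩ := hM0
  let P : Type := Σ i, Fin (D.n i)
  let F : P → k[X] := fun p => (D.f p.1).map (RingHom.id k) ^ D.e p.1
  have hF : ∀ p, F p = D.f p.1 := fun p => by
    simp only [F]
    rw [hss, pow_one, Polynomial.map_id]
  let τ : Equiv.Perm P := Equiv.sigmaCongr σ fun i => finCongr (hσ i).2.2.symm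
  have hτ : ∀ p, F (τ p) = starPoly (F p) := fun p => by
    rw [hF, hF]
    exact (hσ p.1).1
  let p₁ : P := ⟨i₁, 0, D.npos i₁⟩
  let p₀ : P := ⟨i₀, 0, D.npos i₀⟩
  let κ := LinearEquiv.piCurry k[X] fun i (_ : Fin (D.n i)) =>
    PolyQuot ((D.f i).map (RingHom.id k) ^ D.e i)
  have h₀ : D.f i₀ = starPoly (D.f i₀) ∧ (D.f i₀).natDegree = 1 := by
    obtain ⟨a, ha, hf⟩ : ∃ a : k, a * a = 1 ∧ D.f i₀ = X + C a := by
      rcases hi₀ with h | h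
      · exact ⟨-1, by ring, by rw [h, C_neg, C_1, sub_eq_add_neg]⟩
      · exact ⟨1, by ring, by rw [h, C_1]⟩
    rw [hf]
    exact ⟨(starPoly_X_add_C ha).symm, natDegree_X_add_C a⟩
  have hm : ∀ p, (F p).Monic := fun p => hF p ▸ D.monic p.1
  have hfin : ∀ p, FiniteDimensional k (PolyQuot (F p)) :=
    fun p => PolyQuot.finiteDimensional (hm p)
  have hdim : D.dim = Module.finrank k (∀ p, PolyQuot (F p)) := by
    rw [Module.finrank_pi_fintype]
    simp_rw [PolyQuot.finrank_eq, hF]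
    rw [Fintype.sum_sigma, ModuleData.dim]
    refine Finset.sum_congr rfl fun i _ => ?_
    rw [hss, one_mul]
    simp
  obtain ⟨C, Φ, hC, hΦ⟩ := hγ.exists_isGoodForm_equiv hchar F hm (fun p => hF p ▸ D.irr p.1) τ hτ
    (p₁ := p₁) (p₀ := p₀) (by rw [hF]; exact (starPoly_eq_self_of_symm (D.monic _) hsym).symm)
    (by rw [hF]; exact hev) (by rw [hF]; exact h₀.1) (by rw [hF]; exact h₀.2) B hB
    (hV.trans hdim)
  refine hasIsometryWithModule_of_isGoodForm
    (hC.compl₁₂ (κ.symm.restrictScalars k) fun x => κ.symm.map_smul _ _)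
    (Φ.trans (κ.restrictScalars k)) fun x y => ?_
  rw [← hΦ]
  rfl

end
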